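/- arXiv:2204.05026 — 4 statements merged into one kernel-verified Lean document; each statement's English description precedes it below -/
import Mathlib

section
/- Let n be a positive integer divisible by 4 and let Γ = IOCG_n(D,σ) be an integral oriented circulant graph with Hermitian eigenvalues μ_0,…,μ_{n−1} (indices read modulo n). Then Γ has multiple state transfer on the vertex set {b, b + n/4, b + n/2, b + 3n/4} for every b ∈ Z_n if and only if for every j = 0, 1, …, n−1 one has μ_{j+1} − μ_j ≠ 0 with ν₂(μ_{j+1} − μ_j) = 1, and μ_{j+2} − μ_j ≠ 0 with ν₂(μ_{j+2} − μ_j) = 2. -/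
open Complex Finset

noncomputable section

/-- `G_n^r(d) = { dk : k ≡ r (mod 4), gcd(dk, n) = d } ⊆ {1, …, n−1}`. -/
def Gsetr (n r d : ℕ) : Finset ℕ :=
  (Finset.range n).filter (fun a => d ∣ a ∧ (a / d) % 4 = r ∧ Nat.gcd a n = d)

/-- The symbol `C = ⋃_{d ∈ D} S_n(d)` of the integral oriented circulant graph
`IOCG_n(D, σ)`, where `S_n(d) = G_n^1(d)` if `σ d = 1` and `S_n(d) = G_n^3(d)` otherwise. -/
def symbol (n : ℕ) (D : Finset ℕ) (σ : ℕ → ℤ) : Finset ℕ :=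
  D.biUnion (fun d => Gsetr n (if σ d = 1 then 1 else 3) d)

/-- The Hermitian adjacency matrix of the oriented circulant graph with symbol `C`. -/
def hermMatrix (n : ℕ) [NeZero n] (C : Finset ℕ) : Matrix (ZMod n) (ZMod n) ℂ :=
  Matrix.of fun u v =>
    if (v - u).val ∈ C then Complex.I
    else if (u - v).val ∈ C then -Complex.I else 0

/-- The transition matrix `U(t) = exp(i t H)`. -/
def transitionMatrix (n : ℕ) [NeZero n] (C : Finset ℕ) (t : ℝ) :
    Matrix (ZMod n) (ZMod n) ℂ :=
  NormedSpace.exp ((Complex.I * (t : ℂ)) • hermMatrix n C)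

/-- Perfect state transfer from `u` to `v`. -/
def hasPST (n : ℕ) [NeZero n] (C : Finset ℕ) (u v : ZMod n) : Prop :=
  ∃ (t : ℝ) (γ : ℂ), ‖γ‖ = 1 ∧
    (transitionMatrix n C t).mulVec (Pi.single u 1) = γ • (Pi.single v 1 : ZMod n → ℂ)

/-- Multiple state transfer on a vertex set `S`: PST between every pair of
distinct vertices of `S`. -/
def hasMST (n : ℕ) [NeZero n] (C : Finset ℕ) (S : Set (ZMod n)) : Prop :=
  ∀ u ∈ S, ∀ v ∈ S, u ≠ v → hasPST n C u v

/-- The Hermitian eigenvalues `μ_j = i ∑_{k ∈ C} (ω^{jk} − ω^{−jk})`, `ω = exp(2πi/n)`. -/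
def eigval (n : ℕ) (C : Finset ℕ) (j : ℕ) : ℂ :=
  Complex.I * ∑ k ∈ C, (Complex.exp (2 * Real.pi * Complex.I * j * k / n) -
    Complex.exp (-(2 * Real.pi * Complex.I * j * k / n)))

/-- Ramanujan's sum `c_n(q) = ∑_{1 ≤ a ≤ n, gcd(a,n)=1} exp(2πi a q / n)`. -/
def ramanujanSum (n q : ℕ) : ℂ :=
  ∑ a ∈ (Finset.Icc 1 n).filter (fun a => Nat.gcd a n = 1),
    Complex.exp (2 * Real.pi * Complex.I * a * q / n)

/-- Ramanujan's sine sum `s_n(q) = i ∑_{a ∈ G_n^1(1)} (ω^{aq} − ω^{−aq})`. -/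
def sineSum (n q : ℕ) : ℂ :=
  Complex.I * ∑ a ∈ Gsetr n 1 1, (Complex.exp (2 * Real.pi * Complex.I * a * q / n) -
    Complex.exp (-(2 * Real.pi * Complex.I * a * q / n)))

/-- The sign of the residue class of `x` in the oriented circulant graph: `1` if it lies in the
symbol, `-1` if its negative does, and `0` otherwise. -/
def orientation (n : ℕ) (D : Finset ℕ) (σ : ℕ → ℤ) (x : ℤ) : ℤ :=
  if Int.gcd x n ∈ D then σ (Int.gcd x n) * ZMod.χ₄ ((x / (Int.gcd x n : ℤ) : ℤ) : ZMod 4) else 0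

section orientation

variable {n : ℕ} {D : Finset ℕ} {σ : ℕ → ℤ}

lemma exists_four_mul_gcd [NeZero n] (hn4 : 4 ∣ n) (hD : ∀ d ∈ D, d ∣ n / 4) {x : ℤ}
    (hx : Int.gcd x n ∈ D) :
    ∃ s : ℤ, ∃ r : ℕ, 0 < Int.gcd x n ∧ x = Int.gcd x n * s ∧ n = 4 * Int.gcd x n * r ∧
      Int.gcd s (4 * r) = 1 := by
  have hpos : 0 < Int.gcd x n := Int.gcd_pos_of_ne_zero_right _ (by exact_mod_cast NeZero.ne n)
  obtain ⟨r, hr⟩ := hD _ hx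
  obtain ⟨s, hs⟩ := Int.gcd_dvd_left x n
  have hn : n = 4 * Int.gcd x n * r := by rw [mul_assoc, ← hr]; omega
  refine ⟨s, r, hpos, hs, hn, ?_⟩
  have h1 : Int.gcd x n = Int.gcd x n * Int.gcd s (4 * r) := by
    have : (n : ℤ) = Int.gcd x n * (4 * r) := by
      conv_lhs => rw [hn]
      push_cast; ring
    rw [← Int.natAbs_natCast (Int.gcd x n), ← Int.gcd_mul_left, ← hs, ← this,
      Int.natAbs_natCast]
  exact (Nat.mul_left_cancel hpos (by rw [mul_one]; exact h1)).symm

lemma odd_of_gcd_four_mul {s : ℤ} {r : ℕ} (h : Int.gcd s (4 * r) = 1) : s % 2 = 1 := by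
  by_contra h2
  have h3 : (2 : ℤ) ∣ s := by omega
  have := Int.dvd_coe_gcd h3 (show (2 : ℤ) ∣ 4 * r by omega)
  rw [h] at this
  omega

lemma χ₄_int_neg (s : ℤ) : ZMod.χ₄ ((-s : ℤ) : ZMod 4) = -ZMod.χ₄ (s : ZMod 4) := by
  rw [ZMod.χ₄_int_eq_if_mod_four, ZMod.χ₄_int_eq_if_mod_four]
  split_ifs <;> omega

lemma orientation_eq_of_mul {x s : ℤ} {g : ℕ} (hg : 0 < g) (h : Int.gcd x n = g)
    (hx : x = g * s) :
    orientation n D σ x = if g ∈ D then σ g * ZMod.χ₄ (s : ZMod 4) else 0 := by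
  rw [orientation, h, hx, Int.mul_ediv_cancel_left _ (by exact_mod_cast hg.ne')]

lemma orientation_neg (x : ℤ) : orientation n D σ (-x) = -orientation n D σ x := by
  unfold orientation
  rw [Int.neg_gcd, Int.neg_ediv_of_dvd (Int.gcd_dvd_left x n), χ₄_int_neg]
  split_ifs <;> simp

lemma orientation_add_mul [NeZero n] (hn4 : 4 ∣ n) (hD : ∀ d ∈ D, d ∣ n / 4) (x k : ℤ) :
    orientation n D σ (x + n * k) = orientation n D σ x := by
  have hg : Int.gcd (x + n * k) n = Int.gcd x n := by simp
  by_cases hx : Int.gcd x n ∈ D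
  · obtain ⟨s, r, hpos, hs, hr, -⟩ := exists_four_mul_gcd hn4 hD hx
    rw [orientation_eq_of_mul hpos hg (s := s + 4 * r * k),
      orientation_eq_of_mul hpos rfl hs, if_pos hx, if_pos hx]
    · congr 2
      push_cast
      rw [show (4 : ZMod 4) = 0 from rfl]; ring
    · generalize Int.gcd x n = g at *
      rw [hs, hr]; push_cast; ring
  · simp only [orientation, hg, if_neg hx]

lemma orientation_eq_of_zmod [NeZero n] (hn4 : 4 ∣ n) (hD : ∀ d ∈ D, d ∣ n / 4) {x y : ℤ}
    (h : (x : ZMod n) = y) : orientation n D σ x = orientation n D σ y := by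
  obtain ⟨k, hk⟩ := ((ZMod.intCast_eq_intCast_iff_dvd_sub _ _ _).1 h)
  rw [← orientation_add_mul hn4 hD x k, ← hk]; congr 1; ring

lemma gcd_add_half_of_mem [NeZero n] (hn4 : 4 ∣ n) (hD : ∀ d ∈ D, d ∣ n / 4) {h x : ℤ}
    (hh : (n : ℤ) = 2 * h) (hx : Int.gcd x n ∈ D) : Int.gcd (x + h) n = Int.gcd x n := by
  obtain ⟨s, r, hpos, hs, hr, hsr⟩ := exists_four_mul_gcd hn4 hD hx
  have hs2 := odd_of_gcd_four_mul hsr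
  generalize Int.gcd x n = g at *
  have hgr : h = g * (2 * r) := by
    have : (n : ℤ) = 4 * g * r := by exact_mod_cast hr
    linarith
  have hn : (n : ℤ) = g * (4 * r) := by rw [hh, hgr]; ring
  rw [hs, hgr, ← mul_add, hn, Int.gcd_mul_left, Int.natAbs_natCast]
  suffices Int.gcd (s + 2 * r) (4 * r) = 1 by rw [this, mul_one]
  have h1 : IsCoprime s (4 * r : ℤ) := Int.isCoprime_iff_gcd_eq_one.2 hsr
  have h2 : IsCoprime (s + 2 * r) (r : ℤ) := by
    have : IsCoprime s (r : ℤ) := h1.of_mul_right_right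
    simpa [mul_comm] using this.add_mul_left_left 2
  have h3 : IsCoprime (s + 2 * r) (2 : ℤ) := by
    rw [← Int.odd_iff] at hs2
    exact Int.isCoprime_two_right.2 (hs2.add_even (even_two_mul _))
  rw [← Int.isCoprime_iff_gcd_eq_one, show (4 * r : ℤ) = 2 * 2 * r by ring]
  exact (h3.mul_right h3).mul_right h2

/-- Translation by `n / 2` either fixes the orientation or reverses it; it reverses a nonzero one
only at the odd multiples of `2 ^ e`, where `n = 4 * 2 ^ e * m` with `m` odd. -/
lemma orientation_add_half [NeZero n] (hn4 : 4 ∣ n) (hD : ∀ d ∈ D, d ∣ n / 4) {e m : ℕ}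
    (hn : n = 4 * (2 ^ e * m)) (hm : m % 2 = 1) (x : ℤ) :
    orientation n D σ (x + 2 * (2 ^ e * m)) = orientation n D σ x ∨
    (orientation n D σ (x + 2 * (2 ^ e * m)) = -orientation n D σ x ∧
      ∃ a : ℤ, a % 2 = 1 ∧ x = 2 ^ e * a) := by
  have hh : (n : ℤ) = 2 * (2 * (2 ^ e * m)) := by rw [hn]; push_cast; ring
  by_cases hx : Int.gcd x n ∈ D
  · have hg := gcd_add_half_of_mem hn4 hD hh hx
    obtain ⟨s, r, hpos, hs, hr, hsr⟩ := exists_four_mul_gcd hn4 hD hx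
    have hs2 := odd_of_gcd_four_mul hsr
    have hgr : Int.gcd x n * r = 2 ^ e * m := by
      apply Nat.mul_left_cancel (show 0 < 4 by norm_num)
      rw [← hn, ← mul_assoc, ← hr]
    have hgr' : (Int.gcd x n * r : ℤ) = 2 ^ e * m := by exact_mod_cast hgr
    rw [orientation_eq_of_mul hpos hg (s := s + 2 * r), orientation_eq_of_mul hpos rfl hs,
      if_pos hx, if_pos hx]
    · rcases Nat.mod_two_eq_zero_or_one r with h | h
      · left
        congr 1
        rw [ZMod.χ₄_int_eq_if_mod_four, ZMod.χ₄_int_eq_if_mod_four]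
        split_ifs <;> omega
      · right
        constructor
        · rw [← mul_neg]
          congr 1
          rw [ZMod.χ₄_int_eq_if_mod_four, ZMod.χ₄_int_eq_if_mod_four]
          split_ifs <;> omega
        · have hc : Nat.Coprime (2 ^ e) r :=
            Nat.Coprime.pow_left _ (Nat.coprime_two_left.2 (Nat.odd_iff.2 h))
          obtain ⟨g', hg'⟩ := hc.dvd_of_dvd_mul_right (Dvd.intro _ hgr.symm)
          have hm' : g' * r = m := by
            apply Nat.mul_left_cancel (show 0 < 2 ^ e by positivity)
            rw [← mul_assoc, ← hg', hgr]
          refine ⟨g' * s, ?_, ?_⟩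
          · have h1 : Odd g' := by
              have : Odd (g' * r) := by rw [hm', Nat.odd_iff]; exact hm
              exact (Nat.odd_mul.1 this).1
            rw [← Int.odd_iff]
            exact ((Int.odd_coe_nat _).2 h1).mul (Int.odd_iff.2 hs2)
          · rw [← mul_assoc]
            conv_lhs => rw [hs, hg']
            push_cast; ring
    · rw [← hgr', mul_add, ← hs]; ring
  · left
    have hx' : Int.gcd (x + 2 * (2 ^ e * m)) n ∉ D := by
      intro h
      have h1 := gcd_add_half_of_mem hn4 hD hh h
      rw [add_assoc, ← two_mul, ← hh] at h1
      rw [← h1] at h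
      simp at h
      exact hx h
    simp only [orientation, if_neg hx, if_neg hx']

lemma orientation_trichotomy (hσ : ∀ d ∈ D, σ d = 1 ∨ σ d = -1) (x : ℤ) :
    orientation n D σ x = 0 ∨ orientation n D σ x = 1 ∨ orientation n D σ x = -1 := by
  unfold orientation
  split_ifs with h
  · rw [ZMod.χ₄_int_eq_if_mod_four]
    rcases hσ _ h with h | h <;> rw [h] <;> split_ifs <;> simp
  · simp

lemma mem_symbol_iff (hσ : ∀ d ∈ D, σ d = 1 ∨ σ d = -1) (a : ℕ) (ha : a < n) :
    a ∈ symbol n D σ ↔ orientation n D σ a = 1 := by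
  have key : a ∈ symbol n D σ ↔
      Nat.gcd a n ∈ D ∧ (a / Nat.gcd a n) % 4 = if σ (Nat.gcd a n) = 1 then 1 else 3 := by
    simp only [symbol, Gsetr, mem_biUnion, mem_filter, mem_range]
    constructor
    · rintro ⟨d, hd, -, -, h1, rfl⟩
      exact ⟨hd, h1⟩
    · rintro ⟨h1, h2⟩
      exact ⟨_, h1, ha, Nat.gcd_dvd_left _ _, h2, rfl⟩
  rw [key]
  unfold orientation
  rw [Int.gcd_natCast_natCast, ← Int.natCast_ediv, Int.cast_natCast, ZMod.χ₄_nat_eq_if_mod_four]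
  by_cases h : Nat.gcd a n ∈ D
  · rw [if_pos h]
    generalize a / Nat.gcd a n = s
    rcases hσ _ h with h' | h' <;> rw [h'] <;>
      simp only [h, true_and, if_true, show ¬ ((-1 : ℤ) = 1) by norm_num, if_false] <;>
      split_ifs <;> omega
  · simp [h]

end orientation

section spectrum

variable {n : ℕ} [NeZero n] {D : Finset ℕ} {σ : ℕ → ℤ}

open ZMod in
/-- The discrete Fourier transform conjugates a circulant matrix to a diagonal one. -/
lemma dft_exp_circulant_mulVec (A : Matrix (ZMod n) (ZMod n) ℂ) (f l : ZMod n → ℂ)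
    (hA : ∀ u v, A u v = f (v - u)) (hl : ∀ j, l j = ∑ k, f k * stdAddChar (k * j))
    (z : ℂ) (x : ZMod n → ℂ) (j : ZMod n) :
    dft ((NormedSpace.exp (z • A)).mulVec x) j = Complex.exp (z * l j) * dft x j := by
  let F : Matrix (ZMod n) (ZMod n) ℂ := Matrix.of fun j v => stdAddChar (-(v * j))
  have hF (y : ZMod n → ℂ) : dft y = F.mulVec y := by
    ext j
    simp [dft_apply, Matrix.mulVec, dotProduct, F]
  have hsemi : SemiconjBy F (z • A) (Matrix.diagonal fun j => z * l j) := by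
    ext j v
    rw [Matrix.diagonal_mul, Matrix.mul_apply, hl, Finset.mul_sum, Finset.sum_mul]
    refine Fintype.sum_equiv (Equiv.subLeft v) _ _ fun u => ?_
    simp only [F, Matrix.of_apply, Matrix.smul_apply, smul_eq_mul, hA, Equiv.subLeft_apply]
    rw [show -(u * j) = (v - u) * j + -(v * j) by ring, AddChar.map_add_eq_mul]
    ring
  have hexp : SemiconjBy F (NormedSpace.exp (z • A))
      (NormedSpace.exp (Matrix.diagonal fun j => z * l j)) := by
    let : NormedRing (Matrix (ZMod n) (ZMod n) ℂ) := Matrix.linftyOpNormedRing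
    let : NormedAlgebra ℂ (Matrix (ZMod n) (ZMod n) ℂ) := Matrix.linftyOpNormedAlgebra
    let : NormedAlgebra ℚ (Matrix (ZMod n) (ZMod n) ℂ) := NormedAlgebra.restrictScalars ℚ ℂ _
    exact hsemi.exp_right
  rw [hF, hF, Matrix.mulVec_mulVec, hexp.eq, ← Matrix.mulVec_mulVec, Matrix.exp_diagonal,
    Matrix.mulVec_diagonal, Pi.coe_exp, Complex.exp_eq_exp_ℂ]

open ZMod in
lemma dft_single (u j : ZMod n) :
    dft (Pi.single u 1 : ZMod n → ℂ) j = stdAddChar (-(u * j)) := by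
  simp [dft_apply, Pi.single_apply]

/-- Perfect state transfer on a circulant graph in terms of its spectrum. -/
lemma hasPST_iff {C : Finset ℕ} {f l : ZMod n → ℂ} (hf : ∀ u v, hermMatrix n C u v = f (v - u))
    (hl : ∀ j, l j = ∑ k, f k * ZMod.stdAddChar (k * j)) (u v : ZMod n) :
    hasPST n C u v ↔ ∃ (t : ℝ) (γ : ℂ), ‖γ‖ = 1 ∧
      ∀ j, Complex.exp (I * t * l j) * ZMod.stdAddChar (-(u * j)) =
        γ * ZMod.stdAddChar (-(v * j)) := by
  unfold hasPST transitionMatrix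
  refine exists_congr fun t => exists_congr fun γ => and_congr_right fun _ => ?_
  rw [← ZMod.dft.injective.eq_iff, funext_iff]
  refine forall_congr' fun j => ?_
  rw [dft_exp_circulant_mulVec _ f l hf hl, map_smul, Pi.smul_apply, dft_single, dft_single,
    smul_eq_mul]

lemma stdAddChar_natCast (a : ℕ) :
    ZMod.stdAddChar (a : ZMod n) = Complex.exp (2 * Real.pi * I * a / n) := by
  have := ZMod.stdAddChar_coe (N := n) (a : ℤ)
  simpa using this

lemma hermMatrix_symbol_apply (hn4 : 4 ∣ n) (hD : ∀ d ∈ D, d ∣ n / 4)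
    (hσ : ∀ d ∈ D, σ d = 1 ∨ σ d = -1) (u v : ZMod n) :
    hermMatrix n (symbol n D σ) u v = I * (orientation n D σ (v - u).val : ℂ) := by
  have hneg : orientation n D σ (u - v).val = -orientation n D σ (v - u).val := by
    rw [← orientation_neg]
    apply orientation_eq_of_zmod hn4 hD
    simp
  simp only [hermMatrix, Matrix.of_apply, mem_symbol_iff hσ _ (ZMod.val_lt _), hneg]
  rcases orientation_trichotomy (n := n) hσ ((v - u).val : ℤ) with h | h | h <;> rw [h] <;> simp

lemma sum_zmod_eq_sum_range {M : Type*} [AddCommMonoid M] (F : ZMod n → M) :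
    ∑ k, F k = ∑ k ∈ range n, F (k : ZMod n) := by
  refine Finset.sum_bij' (fun k _ => k.val) (fun k _ => (k : ZMod n)) ?_ ?_ ?_ ?_ ?_
  · intro k _; simpa using ZMod.val_lt k
  · intros; simp
  · intro k _; simp
  · intro k hk; exact ZMod.val_cast_of_lt (mem_range.1 hk)
  · intro k _; simp

lemma eigval_symbol (hn4 : 4 ∣ n) (hD : ∀ d ∈ D, d ∣ n / 4)
    (hσ : ∀ d ∈ D, σ d = 1 ∨ σ d = -1) (j : ℕ) :
    eigval n (symbol n D σ) j =
      ∑ k : ZMod n, I * (orientation n D σ k.val : ℂ) * ZMod.stdAddChar (k * (j : ZMod n)) := by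
  have hC : symbol n D σ ⊆ range n := by
    intro a ha
    simp only [symbol, Gsetr, mem_biUnion, mem_filter] at ha
    obtain ⟨d, -, h, -⟩ := ha
    exact h
  have h1 : eigval n (symbol n D σ) j = I * ∑ k : ZMod n,
      if orientation n D σ k.val = 1 then
        (ZMod.stdAddChar (k * (j : ZMod n)) - ZMod.stdAddChar (-k * (j : ZMod n)) : ℂ) else 0 := by
    rw [sum_zmod_eq_sum_range, eigval, ← Finset.inter_eq_right.2 hC, ← Finset.filter_mem_eq_inter,
      Finset.sum_filter]
    congr 1
    refine Finset.sum_congr rfl fun k hk => ?_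
    have hk' := mem_range.1 hk
    rw [ZMod.val_cast_of_lt hk', neg_mul, AddChar.map_neg_eq_inv, ← Nat.cast_mul,
      stdAddChar_natCast, ← Complex.exp_neg]
    simp only [mem_symbol_iff hσ k hk']
    refine if_congr Iff.rfl ?_ rfl
    push_cast
    congr 2 <;> ring
  have h2 (k : ZMod n) : orientation n D σ (-k).val = -orientation n D σ k.val := by
    rw [← orientation_neg]
    apply orientation_eq_of_zmod hn4 hD
    simp
  have h3 : ∑ k : ZMod n, (if orientation n D σ k.val = 1 then
        (ZMod.stdAddChar (-k * (j : ZMod n)) : ℂ) else 0) =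
      ∑ k : ZMod n, if orientation n D σ k.val = -1 then (ZMod.stdAddChar (k * (j : ZMod n)) : ℂ) else 0 := by
    refine Fintype.sum_equiv (Equiv.neg _) _ _ fun k => ?_
    simp only [Equiv.neg_apply, h2]
    simp [neg_inj]
  rw [h1]
  have h4 (p : Prop) [Decidable p] (a b : ℂ) :
    (if p then a - b else 0) = (if p then a else 0) - if p then b else 0 := by split_ifs <;> simp
  simp only [h4]
  rw [Finset.sum_sub_distrib, h3, ← Finset.sum_sub_distrib, Finset.mul_sum]
  refine Finset.sum_congr rfl fun k _ => ?_
  rcases orientation_trichotomy (n := n) hσ (k.val : ℤ) with h | h | h <;> rw [h] <;> norm_num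

end spectrum

lemma two_dvd_of_isIntegral_div_two {a : ℤ} (h : IsIntegral ℤ ((a : ℂ) / 2)) : 2 ∣ a := by
  have h1 : IsIntegral ℤ (algebraMap ℚ ℂ ((a : ℚ) / 2)) := by simpa using h
  rw [isIntegral_algebraMap_iff (algebraMap ℚ ℂ).injective] at h1
  obtain ⟨b, hb⟩ := IsIntegrallyClosed.isIntegral_iff.1 h1
  refine ⟨b, ?_⟩
  simp only [eq_intCast] at hb
  field_simp at hb
  exact_mod_cast hb.symm.trans (mul_comm _ _)

lemma isIntegral_I : IsIntegral ℤ I :=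
  IsIntegral.of_pow (n := 2) two_pos (by rw [I_sq]; exact isIntegral_one.neg)

lemma isIntegral_stdAddChar {n : ℕ} [NeZero n] (x : ZMod n) :
    IsIntegral ℤ (ZMod.stdAddChar x) := by
  refine IsIntegral.of_pow (Nat.pos_of_ne_zero (NeZero.ne n)) ?_
  rw [← AddChar.map_nsmul_eq_pow]
  simpa using isIntegral_one

lemma sum_range_mul_of_periodic {p : ℕ} (F : ℕ → ℂ) (hF : ∀ j, F (j + p) = F j) (q : ℕ) :
    ∑ j ∈ range (q * p), F j = q * ∑ j ∈ range p, F j := by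
  have hF' (q j : ℕ) : F (q * p + j) = F j := by
    induction q with
    | zero => simp
    | succ q ih => rw [← ih, ← hF (q * p + j)]; congr 1; ring
  induction q with
  | zero => simp
  | succ q ih =>
    rw [add_mul, one_mul, Finset.sum_range_add, ih]
    simp only [hF']
    push_cast; ring

section parity

variable {n : ℕ} [NeZero n] {D : Finset ℕ} {σ : ℕ → ℤ} {M : ZMod n → ℤ} {e m : ℕ}

lemma stdAddChar_half (hn : n = 4 * (2 ^ e * m)) {a : ℤ} (ha : a % 2 = 1) :
    ZMod.stdAddChar (((2 * (2 ^ e * m) : ℕ) : ZMod n) * (a : ZMod n)) = -1 := by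
  have hn0 : (n : ℂ) ≠ 0 := by exact_mod_cast NeZero.ne n
  have h1 : ZMod.stdAddChar ((2 * (2 ^ e * m) : ℕ) : ZMod n) = (-1 : ℂ) := by
    rw [stdAddChar_natCast, ← Complex.exp_pi_mul_I]
    congr 1
    rw [div_eq_iff hn0, hn]
    push_cast; ring
  rw [mul_comm, ← zsmul_eq_mul, AddChar.map_zsmul_eq_zpow, h1]
  exact (Int.odd_iff.2 ha).neg_one_zpow

lemma eigenvalue_odd (hn4 : 4 ∣ n) (hD : ∀ d ∈ D, d ∣ n / 4)
    (hM : ∀ j, (M j : ℂ) = ∑ k : ZMod n, I * (orientation n D σ k.val : ℂ) *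
      ZMod.stdAddChar (k * j))
    (hn : n = 4 * (2 ^ e * m)) {j : ℕ} (hj : j % 2 = 1) :
    (M j : ℂ) = ∑ k ∈ range (2 * (2 ^ e * m)), I * ((orientation n D σ k -
      orientation n D σ (k + 2 * (2 ^ e * m)) : ℤ) : ℂ) * ZMod.stdAddChar ((k : ZMod n) * (j : ZMod n)) := by
  have hval (k : ℕ) : orientation n D σ (k : ZMod n).val = orientation n D σ k :=
    orientation_eq_of_zmod hn4 hD (by simp)
  have hhalf := stdAddChar_half hn (a := j) (by omega)
  rw [hM, sum_zmod_eq_sum_range]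
  simp only [hval]
  rw [show range n = range (2 * (2 ^ e * m) + 2 * (2 ^ e * m)) by congr 1; omega,
    Finset.sum_range_add, ← Finset.sum_add_distrib]
  refine Finset.sum_congr rfl fun k _ => ?_
  rw [Nat.cast_add (R := ZMod n), add_mul, AddChar.map_add_eq_mul]
  rw [Int.cast_natCast] at hhalf
  rw [hhalf, add_comm (2 * (2 ^ e * m)) k]
  push_cast; ring

lemma two_dvd_eigenvalue (hn4 : 4 ∣ n) (hD : ∀ d ∈ D, d ∣ n / 4)
    (hM : ∀ j, (M j : ℂ) = ∑ k : ZMod n, I * (orientation n D σ k.val : ℂ) *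
      ZMod.stdAddChar (k * j))
    (hn : n = 4 * (2 ^ e * m)) (hm : m % 2 = 1) {j : ℕ} (hj : j % 2 = 1) : 2 ∣ M j := by
  apply two_dvd_of_isIntegral_div_two
  rw [eigenvalue_odd hn4 hD hM hn hj, Finset.sum_div]
  refine IsIntegral.sum _ fun k _ => ?_
  obtain ⟨c, hc⟩ : ∃ c, orientation n D σ k - orientation n D σ (k + 2 * (2 ^ e * m)) = 2 * c := by
    rcases orientation_add_half (σ := σ) hn4 hD hn hm k with h | ⟨h, -⟩
    · exact ⟨0, by rw [h]; ring⟩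
    · exact ⟨orientation n D σ k, by rw [h]; ring⟩
  rw [hc, show I * ((2 * c : ℤ) : ℂ) * ZMod.stdAddChar ((k : ZMod n) * (j : ZMod n)) / 2 =
    I * c * ZMod.stdAddChar ((k : ZMod n) * (j : ZMod n)) by push_cast; ring]
  exact (isIntegral_I.mul (isIntegral_intCast c)).mul (isIntegral_stdAddChar _)

lemma stdAddChar_two_mul (hn : n = 4 * (2 ^ e * m)) {k a : ℤ} (ha : a % 2 = 1)
    (hk : k = 2 ^ e * a) : ZMod.stdAddChar ((k : ZMod n) * ((2 * m : ℕ) : ZMod n)) = -1 := by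
  rw [← stdAddChar_half hn ha]
  congr 1
  rw [hk]; push_cast; ring

lemma eigenvalue_add_two_mul (hn4 : 4 ∣ n) (hD : ∀ d ∈ D, d ∣ n / 4)
    (hM : ∀ j, (M j : ℂ) = ∑ k : ZMod n, I * (orientation n D σ k.val : ℂ) *
      ZMod.stdAddChar (k * j))
    (hn : n = 4 * (2 ^ e * m)) (hm : m % 2 = 1) {j : ℕ} (hj : j % 2 = 1) :
    M (j + 2 * m : ℕ) = -M j := by
  have : (M (j + 2 * m : ℕ) : ℂ) = -M j := by
    rw [eigenvalue_odd hn4 hD hM hn hj, eigenvalue_odd hn4 hD hM hn (by omega),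
      ← Finset.sum_neg_distrib]
    refine Finset.sum_congr rfl fun k _ => ?_
    rcases orientation_add_half (σ := σ) hn4 hD hn hm k with h | ⟨-, a, ha, hk⟩
    · rw [h]; simp
    · have := stdAddChar_two_mul hn ha hk
      rw [Int.cast_natCast] at this
      rw [Nat.cast_add (R := ZMod n), mul_add, AddChar.map_add_eq_mul, this]
      ring
  exact_mod_cast this

open ZMod in
lemma sum_eigenvalue_mul_stdAddChar
    (hM : ∀ j, (M j : ℂ) = ∑ k : ZMod n, I * (orientation n D σ k.val : ℂ) *
      ZMod.stdAddChar (k * j)) (k : ZMod n) :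
    ∑ j, (M j : ℂ) * stdAddChar (-(k * j)) = n * (I * orientation n D σ k.val) := by
  have h1 : (fun j => (M j : ℂ)) =
      fun j => dft (fun k : ZMod n => I * (orientation n D σ k.val : ℂ)) (-j) := by
    ext j
    rw [hM, dft_apply]
    refine Finset.sum_congr rfl fun k _ => ?_
    rw [mul_neg, neg_neg, smul_eq_mul, mul_comm]
  have h2 : dft (fun j => (M j : ℂ)) k = n * (I * orientation n D σ k.val) := by
    rw [h1, dft_comp_neg, dft_dft]
    simp
  rw [← h2, dft_apply]
  refine Finset.sum_congr rfl fun j _ => ?_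
  rw [smul_eq_mul, mul_comm, mul_comm k j]

lemma eigenvalue_one_eq_zero (hn4 : 4 ∣ n) (hD : ∀ d ∈ D, d ∣ n / 4)
    (hσ : ∀ d ∈ D, σ d = 1 ∨ σ d = -1)
    (hM : ∀ j, (M j : ℂ) = ∑ k : ZMod n, I * (orientation n D σ k.val : ℂ) *
      ZMod.stdAddChar (k * j))
    (hn : n = 4 * (2 ^ e * m)) (hm : m % 2 = 1) (h4 : ∀ j, 4 ∣ M j) : M 1 = 0 := by
  by_contra hne
  have hval (k : ℕ) : orientation n D σ (k : ZMod n).val = orientation n D σ k :=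
    orientation_eq_of_zmod hn4 hD (by simp)
  obtain ⟨k, hk⟩ : ∃ k : ℕ, orientation n D σ (k + 2 * (2 ^ e * m)) ≠ orientation n D σ k := by
    by_contra! hall
    apply hne
    have := eigenvalue_odd hn4 hD hM hn (j := 1) rfl
    simp only [hall] at this
    simpa using this
  obtain ⟨hk1, a, ha, hka⟩ := (orientation_add_half (σ := σ) hn4 hD hn hm k).resolve_left hk
  have hk0 : orientation n D σ k ≠ 0 := by
    intro h0; rw [hk1, h0] at hk; exact hk rfl
  let F : ℕ → ℂ := fun j => if j % 2 = 1 then (M j : ℂ) * ZMod.stdAddChar (-((k : ZMod n) * (j : ZMod n)))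
    else 0
  have hFper (j : ℕ) : F (j + 2 * m) = F j := by
    have h1 : (j + 2 * m) % 2 = j % 2 := by omega
    simp only [F, h1]
    split_ifs with hj
    · have := stdAddChar_two_mul hn ha hka
      rw [Int.cast_natCast] at this
      rw [eigenvalue_add_two_mul hn4 hD hM hn hm hj, Nat.cast_add (R := ZMod n), mul_add, neg_add,
        AddChar.map_add_eq_mul, AddChar.map_neg_eq_inv _ (_ * ((2 * m : ℕ) : ZMod n)), this]
      norm_num
    · rfl
  have hFsum : ∑ j ∈ range n, F j = n * (I * orientation n D σ k) := by
    have h1 := sum_eigenvalue_mul_stdAddChar hM (k : ZMod n)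
    have h2 := sum_eigenvalue_mul_stdAddChar hM ((k + 2 * (2 ^ e * m) : ℕ) : ZMod n)
    rw [hval, sum_zmod_eq_sum_range] at h1 h2
    push_cast at h2
    rw [hk1] at h2
    have h3 : ∑ j ∈ range n, (2 * F j) = 2 * (n * (I * orientation n D σ k)) := by
      calc _ = ∑ j ∈ range n, ((M j : ℂ) * ZMod.stdAddChar (-((k : ZMod n) * (j : ZMod n))) -
            (M j : ℂ) * ZMod.stdAddChar (-(((k : ZMod n) + 2 * (2 ^ e * (m : ZMod n))) * (j : ZMod n)))) := by
            refine Finset.sum_congr rfl fun j _ => ?_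
            have hchar : ZMod.stdAddChar ((2 * (2 ^ e * m)  : ZMod n) * (j : ZMod n)) = (-1 : ℂ) ^ j := by
              have := stdAddChar_half hn (a := 1) rfl
              rw [mul_comm, ← nsmul_eq_mul, AddChar.map_nsmul_eq_pow]
              congr 1
              simpa using this
            rw [add_mul, neg_add, AddChar.map_add_eq_mul,
              AddChar.map_neg_eq_inv _ (2 * (2 ^ e * m) * (j : ZMod n)), hchar]
            simp only [F]
            rcases Nat.mod_two_eq_zero_or_one j with hj | hj
            · rw [(Nat.even_iff.2 hj).neg_one_pow]; simp [hj]
            · rw [(Nat.odd_iff.2 hj).neg_one_pow, if_pos hj]; norm_num; ring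
        _ = _ := by rw [Finset.sum_sub_distrib, h1, h2]; push_cast; ring
    rw [← Finset.mul_sum] at h3
    exact mul_left_cancel₀ two_ne_zero h3
  have hblock : (m : ℂ) * (I * orientation n D σ k) / 2 = ∑ j ∈ range (2 * m), F j / 4 := by
    have h1 : range n = range ((2 * 2 ^ e) * (2 * m)) := by congr 1; rw [hn]; ring
    rw [h1, sum_range_mul_of_periodic F hFper] at hFsum
    have h2 : (n : ℂ) = 4 * (2 ^ e * m) := by
      conv_lhs => rw [hn]
      push_cast; ring
    rw [h2] at hFsum
    push_cast at hFsum
    have h3 : (2 : ℂ) * 2 ^ e ≠ 0 := by simp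
    rw [← Finset.sum_div]
    apply mul_left_cancel₀ h3
    linear_combination -hFsum / 4
  have hint : IsIntegral ℤ ((m : ℂ) * (I * orientation n D σ k) / 2) := by
    rw [hblock]
    refine IsIntegral.sum _ fun j _ => ?_
    simp only [F]
    split_ifs
    · obtain ⟨c, hc⟩ := h4 j
      rw [hc, show (((4 * c : ℤ) : ℂ) * ZMod.stdAddChar (-((k : ZMod n) * (j : ZMod n)))) / 4 =
        c * ZMod.stdAddChar (-((k : ZMod n) * (j : ZMod n))) by push_cast; ring]
      exact (isIntegral_intCast c).mul (isIntegral_stdAddChar _)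
    · simpa using isIntegral_zero
  have hdvd : (2 : ℤ) ∣ m * orientation n D σ k := by
    apply two_dvd_of_isIntegral_div_two
    have h1 : ((m * orientation n D σ k : ℤ) : ℂ) / 2 =
        (m : ℂ) * (I * orientation n D σ k) / 2 * -I := by
      push_cast
      linear_combination ((m * orientation n D σ k : ℂ) / 2) * Complex.I_mul_I
    rw [h1]
    exact hint.mul isIntegral_I.neg
  rcases orientation_trichotomy (n := n) hσ k with h | h | h
  · exact hk0 h
  · rw [h] at hdvd; omega
  · rw [h] at hdvd; omega

end parity

lemma stdAddChar_quarter {n : ℕ} [NeZero n] (hn4 : 4 ∣ n) :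
    ZMod.stdAddChar ((n / 4 : ℕ) : ZMod n) = I := by
  obtain ⟨r, hr⟩ := hn4
  have hn0 : (n : ℂ) ≠ 0 := by exact_mod_cast NeZero.ne n
  have h1 : n / 4 = r := by omega
  rw [stdAddChar_natCast, h1, ← Complex.exp_pi_div_two_mul_I]
  congr 1
  rw [div_eq_iff hn0, hr, Complex.exp_pi_div_two_mul_I]
  push_cast; ring

section transfer

variable {n : ℕ} [NeZero n] {C : Finset ℕ} {M : ZMod n → ℤ}

/-- Perfect state transfer over a quarter turn forces the scaled eigenvalue gaps to be congruent
to `-1` modulo `4`. -/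
lemma exists_time_of_hasPST_quarter (hn4 : 4 ∣ n)
    (hiff : ∀ u v, hasPST n C u v ↔ ∃ (t : ℝ) (γ : ℂ), ‖γ‖ = 1 ∧
      ∀ j, Complex.exp (I * t * M j) * ZMod.stdAddChar (-(u * j)) =
        γ * ZMod.stdAddChar (-(v * j)))
    (h : hasPST n C 0 ((n / 4 : ℕ) : ZMod n)) :
    ∃ t : ℝ, ∀ j, ∃ a : ℤ, t * ((M (j + 1) - M j : ℤ) : ℝ) = 4 * a - 1 := by
  obtain ⟨t, γ, hγ, hj⟩ := (hiff _ _).1 h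
  refine ⟨2 * t / Real.pi, fun j => ?_⟩
  have h0 := hj j
  have h1 := hj (j + 1)
  rw [zero_mul, neg_zero, AddChar.map_zero_eq_one, mul_one] at h0 h1
  rw [mul_add, mul_one, neg_add, AddChar.map_add_eq_mul, ← mul_assoc, ← h0,
    AddChar.map_neg_eq_inv _ ((n / 4 : ℕ) : ZMod n), stdAddChar_quarter hn4, inv_I] at h1
  have h2 : Complex.exp (I * t * (M (j + 1) - M j)) = Complex.exp (-(Real.pi / 2 * I)) := by
    rw [Complex.exp_neg, Complex.exp_pi_div_two_mul_I, inv_I, mul_sub, Complex.exp_sub, h1,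
      mul_div_cancel_left₀ _ (Complex.exp_ne_zero _)]
  obtain ⟨k, hk⟩ := Complex.exp_eq_exp_iff_exists_int.1 h2
  refine ⟨k, ?_⟩
  have h3 : t * (M (j + 1) - M j : ℝ) = -(Real.pi / 2) + k * (2 * Real.pi) := by
    have h4 : I * ((t * (M (j + 1) - M j : ℝ) : ℝ) : ℂ) =
        I * ((-(Real.pi / 2) + k * (2 * Real.pi) : ℝ) : ℂ) := by
      push_cast
      linear_combination hk
    exact_mod_cast mul_left_cancel₀ I_ne_zero h4
  have hpi := Real.pi_ne_zero
  push_cast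
  field_simp
  linear_combination 2 * h3

/-- If all eigenvalue gaps are twice an integer congruent to a fixed `c = ± 1` modulo `4`, there is
perfect state transfer between any two vertices differing by a multiple of `n / 4`. -/
lemma hasPST_of_gap (hn4 : 4 ∣ n)
    (hiff : ∀ u v, hasPST n C u v ↔ ∃ (t : ℝ) (γ : ℂ), ‖γ‖ = 1 ∧
      ∀ j, Complex.exp (I * t * M j) * ZMod.stdAddChar (-(u * j)) =
        γ * ZMod.stdAddChar (-(v * j)))
    {c : ℤ} (hc : c * c = 1) (hgap : ∀ j, ∃ z, M (j + 1) - M j = 2 * (c + 4 * z))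
    (u : ZMod n) (s : ℤ) : hasPST n C u (u + (s : ZMod n) * ((n / 4 : ℕ) : ZMod n)) := by
  have hstep (j : ZMod n) : Complex.exp (I * (Real.pi / 4 * (-c * s) : ℝ) * M (j + 1)) =
      Complex.exp (I * (Real.pi / 4 * (-c * s) : ℝ) * M j) * I ^ (-s) := by
    obtain ⟨z, hz⟩ := hgap j
    have hz' : (M (j + 1) : ℂ) = M j + 2 * (c + 4 * z) := by
      rw [← sub_eq_iff_eq_add']; exact_mod_cast hz
    have hc' : (c : ℂ) * c = 1 := by exact_mod_cast hc
    have hI : I ^ (-s) = Complex.exp ((-s : ℤ) * (Real.pi / 2 * I)) := by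
      rw [Complex.exp_int_mul, Complex.exp_pi_div_two_mul_I]
    rw [hI, ← Complex.exp_add, Complex.exp_eq_exp_iff_exists_int]
    refine ⟨-c * s * z, ?_⟩
    rw [hz']
    push_cast
    linear_combination (-(Real.pi * s * I / 2) : ℂ) * hc'
  have hchar (j : ZMod n) :
      ZMod.stdAddChar (-((u + (s : ZMod n) * ((n / 4 : ℕ) : ZMod n)) * (j + 1))) =
      ZMod.stdAddChar (-((u + (s : ZMod n) * ((n / 4 : ℕ) : ZMod n)) * j)) *
        ZMod.stdAddChar (-u) * I ^ (-s) := by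
    rw [← stdAddChar_quarter hn4, ← AddChar.map_zsmul_eq_zpow, ← AddChar.map_add_eq_mul,
      ← AddChar.map_add_eq_mul, zsmul_eq_mul]
    congr 1
    push_cast; ring
  rw [hiff]
  refine ⟨Real.pi / 4 * (-c * s), Complex.exp (I * (Real.pi / 4 * (-c * s) : ℝ) * M 0), ?_, ?_⟩
  · rw [show I * (Real.pi / 4 * (-c * s) : ℝ) * M 0 =
      ((Real.pi / 4 * (-c * s) * M 0 : ℝ) : ℂ) * I by push_cast; ring]
    exact Complex.norm_exp_ofReal_mul_I _
  · have key (k : ℕ) : Complex.exp (I * (Real.pi / 4 * (-c * s) : ℝ) * M (k : ZMod n)) *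
        ZMod.stdAddChar (-(u * (k : ZMod n))) =
        Complex.exp (I * (Real.pi / 4 * (-c * s) : ℝ) * M 0) *
          ZMod.stdAddChar (-((u + (s : ZMod n) * ((n / 4 : ℕ) : ZMod n)) * (k : ZMod n))) := by
      induction k with
      | zero => simp
      | succ k ih =>
        rw [Nat.cast_succ, hstep, hchar, mul_add u, mul_one, neg_add, AddChar.map_add_eq_mul]
        linear_combination ZMod.stdAddChar (-u) * I ^ (-s) * ih
    intro j
    simpa using key j.val

end transfer

lemma padicValInt_two_eq_one_iff (x : ℤ) : x ≠ 0 ∧ padicValInt 2 x = 1 ↔ x % 4 = 2 := by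
  have h1 := padicValInt_dvd_iff (p := 2) 1 x
  have h2 := padicValInt_dvd_iff (p := 2) 2 x
  norm_num at h1 h2
  omega

lemma padicValInt_two_eq_two_iff (x : ℤ) : x ≠ 0 ∧ padicValInt 2 x = 2 ↔ x % 8 = 4 := by
  have h2 := padicValInt_dvd_iff (p := 2) 2 x
  have h3 := padicValInt_dvd_iff (p := 2) 3 x
  norm_num at h2 h3
  omega

/-- Integers proportional to integers congruent to `-1` modulo `4`, one of them being twice
an odd number, are congruent modulo `8`. -/
lemma emod_eight_of_cross_mul {x y a b : ℤ} (h : x * (4 * b - 1) = y * (4 * a - 1))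
    (hx : x % 4 = 2) : y % 8 = x % 8 := by
  obtain ⟨w, rfl⟩ : ∃ w, y = 2 * w := ⟨y / 2, by
    have : y = 2 * (2 * (y * a) + (x / 2) * (1 - 4 * b)) := by
      have hx' : x = 2 * (x / 2) := by omega
      linear_combination h - (4 * b - 1) * hx'
    omega⟩
  obtain ⟨v, rfl⟩ : ∃ v, x = 2 * v := ⟨x / 2, by omega⟩
  have : w = v + 4 * (w * a - v * b) := by
    have h1 : v * (4 * b - 1) = w * (4 * a - 1) := by linarith
    linear_combination h1
  omega

theorem mst_iff_val_conditions (n : ℕ) [NeZero n] (hn4 : 4 ∣ n)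
    (D : Finset ℕ) (hD : ∀ d ∈ D, d ∣ n / 4)
    (σ : ℕ → ℤ) (hσ : ∀ d ∈ D, σ d = 1 ∨ σ d = -1)
    (μ : ℕ → ℤ) (hμ : ∀ j < n, (μ j : ℂ) = eigval n (symbol n D σ) j) :
    (∀ b : ZMod n, hasMST n (symbol n D σ)
        {b, b + (n / 4 : ℕ), b + (n / 2 : ℕ), b + (3 * n / 4 : ℕ)}) ↔
      (∀ j < n, (μ ((j + 1) % n) - μ j ≠ 0 ∧
          padicValInt 2 (μ ((j + 1) % n) - μ j) = 1) ∧
        (μ ((j + 2) % n) - μ j ≠ 0 ∧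
          padicValInt 2 (μ ((j + 2) % n) - μ j) = 2)) := by
  obtain ⟨e, m, hm, hem⟩ := Nat.exists_eq_two_pow_mul_odd (n := n / 4)
    (by have := NeZero.ne n; omega)
  rw [Nat.odd_iff] at hm
  have hn : n = 4 * (2 ^ e * m) := by omega
  let M : ZMod n → ℤ := fun j => μ j.val
  have hM (j : ZMod n) : (M j : ℂ) = ∑ k : ZMod n, I * (orientation n D σ k.val : ℂ) *
      ZMod.stdAddChar (k * j) := by
    rw [hμ _ (ZMod.val_lt j), eigval_symbol hn4 hD hσ]
    simp
  have hiff := hasPST_iff (C := symbol n D σ)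
    (hermMatrix_symbol_apply hn4 hD hσ)
    (f := fun k => I * (orientation n D σ k.val : ℂ)) (l := fun j => (M j : ℂ)) hM
  have hrhs : (∀ j < n, (μ ((j + 1) % n) - μ j ≠ 0 ∧
          padicValInt 2 (μ ((j + 1) % n) - μ j) = 1) ∧
        (μ ((j + 2) % n) - μ j ≠ 0 ∧
          padicValInt 2 (μ ((j + 2) % n) - μ j) = 2)) ↔
      ∀ j : ZMod n, (M (j + 1) - M j) % 4 = 2 ∧ (M (j + 1 + 1) - M j) % 8 = 4 := by
    have hMn (k : ℕ) : M (k : ZMod n) = μ (k % n) := by simp only [M, ZMod.val_natCast]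
    have hMadd (j : ZMod n) (k : ℕ) : μ ((j.val + k) % n) = M (j + k) := by
      rw [← hMn]; simp
    simp only [padicValInt_two_eq_one_iff, padicValInt_two_eq_two_iff]
    constructor
    · intro h j
      have := h j.val (ZMod.val_lt j)
      rw [hMadd, hMadd] at this
      rw [add_assoc, one_add_one_eq_two]
      simpa using this
    · intro h j hj
      have := h (j : ZMod n)
      rw [add_assoc, one_add_one_eq_two] at this
      have h1 : μ j = M (j : ZMod n) := by rw [hMn, Nat.mod_eq_of_lt hj]
      rw [h1, ← hMn, ← hMn]
      simpa using this
  rw [hrhs]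
  constructor
  · intro h
    have hq : ((n / 4 : ℕ) : ZMod n) ≠ 0 := by
      rw [Ne, ZMod.natCast_eq_zero_iff]
      have := NeZero.ne n
      exact Nat.not_dvd_of_pos_of_lt (by omega) (by omega)
    obtain ⟨t, ht⟩ := exists_time_of_hasPST_quarter hn4 hiff
      (h 0 0 (by simp) _ (by simp) hq.symm)
    choose a ha using ht
    have hcross (j k : ZMod n) : (M (j + 1) - M j) * (4 * a k - 1) =
        (M (k + 1) - M k) * (4 * a j - 1) := by
      have : ((M (j + 1) - M j : ℤ) : ℝ) * (4 * a k - 1) =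
          ((M (k + 1) - M k : ℤ) : ℝ) * (4 * a j - 1) := by
        rw [← ha, ← ha]; ring
      exact_mod_cast this
    have hM0 : M 0 = 0 := by
      have h1 := hμ 0 (Nat.pos_of_ne_zero (NeZero.ne n))
      simp only [eigval, M, ZMod.val_zero] at h1 ⊢
      simpa using h1
    have hM1 : 2 ∣ M 1 := by
      simpa using two_dvd_eigenvalue hn4 hD hM hn hm (j := 1) rfl
    have hM1' : M 1 ≠ 0 := by
      intro h1
      have h2 := ha 0
      rw [zero_add, h1, hM0] at h2
      have h3 : 4 * a 0 - 1 = 0 := by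
        have : (4 * a 0 - 1 : ℝ) = 0 := by rw [← h2]; simp
        exact_mod_cast this
      omega
    have hmod : M 1 % 4 = 2 := by
      by_contra hne
      apply hM1'
      apply eigenvalue_one_eq_zero hn4 hD hσ hM hn hm
      have key (k : ℕ) : 4 ∣ M (k : ZMod n) := by
        induction k with
        | zero => simp [hM0]
        | succ k ih =>
          have h1 := hcross 0 (k : ZMod n)
          rw [zero_add, hM0, sub_zero] at h1
          obtain ⟨c, hc⟩ : 4 ∣ M 1 := by omega
          rw [hc] at h1
          have h2 : M (k + 1 : ZMod n) - M (k : ZMod n) =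
              4 * ((M (k + 1 : ZMod n) - M (k : ZMod n)) * a 0 -
                c * (4 * a (k : ZMod n) - 1)) := by
            linear_combination h1
          rw [Nat.cast_succ]
          omega
      intro j
      simpa using key j.val
    have hgap (j : ZMod n) : (M (j + 1) - M j) % 8 = M 1 % 8 := by
      have h1 := hcross 0 j
      rw [zero_add, hM0, sub_zero] at h1
      exact emod_eight_of_cross_mul h1 hmod
    intro j
    have h1 := hgap j
    have h2 := hgap (j + 1)
    omega
  · intro h b
    obtain ⟨c, hc, hc'⟩ : ∃ c : ℤ, c * c = 1 ∧ (M 1 - M 0) % 8 = (2 * c) % 8 := by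
      have h1 := (h 0).1
      rw [zero_add] at h1
      rcases (by omega : (M 1 - M 0) % 8 = 2 ∨ (M 1 - M 0) % 8 = 6) with h2 | h2
      · exact ⟨1, by norm_num, by omega⟩
      · exact ⟨-1, by norm_num, by omega⟩
    have hgap (k : ℕ) : (M ((k : ZMod n) + 1) - M k) % 8 = (2 * c) % 8 := by
      induction k with
      | zero => simpa using hc'
      | succ k ih =>
        have h1 := h (k : ZMod n)
        have h2 := h ((k : ZMod n) + 1)
        rw [Nat.cast_succ]
        omega
    have hpst (u : ZMod n) (s : ℤ) := hasPST_of_gap hn4 hiff hc (fun j => by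
      have h1 := hgap j.val
      rw [ZMod.natCast_zmod_val] at h1
      exact ⟨(M (j + 1) - M j - 2 * c) / 8, by omega⟩) u s
    have hmem (u : ZMod n) (hu : u ∈ ({b, b + (n / 4 : ℕ), b + (n / 2 : ℕ),
        b + (3 * n / 4 : ℕ)} : Set (ZMod n))) :
        ∃ s : ℤ, u = b + (s : ZMod n) * ((n / 4 : ℕ) : ZMod n) := by
      have h2 : n / 2 = 2 * (n / 4) := by omega
      have h3 : 3 * n / 4 = 3 * (n / 4) := by omega
      rcases hu with rfl | rfl | rfl | rfl
      · exact ⟨0, by simp⟩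
      · exact ⟨1, by simp⟩
      · exact ⟨2, by rw [h2]; push_cast; rfl⟩
      · exact ⟨3, by rw [h3]; push_cast; rfl⟩
    intro u hu v hv _
    obtain ⟨s, rfl⟩ := hmem u hu
    obtain ⟨s', rfl⟩ := hmem v hv
    convert hpst (b + (s : ZMod n) * ((n / 4 : ℕ) : ZMod n)) (s' - s) using 1
    push_cast; ring

end
end

section
/- Let n be a positive integer divisible by 4 and let Γ = IOCG_n(D,σ) be an integral oriented circulant graph with Hermitian eigenvalues μ_0,…,μ_{n−1}, and assume D₃ = {d ∈ D : ν₂(n/d) = 3} is nonempty (so 8 divides n). Then μ_j is divisible by 4 for every j with 1 ≤ j ≤ n−1 and j ≡ 2 (mod 4), and the integers μ_j/4, as j ranges over the integers with 1 ≤ j ≤ n−1 and j ≡ 2 (mod 4), all have the same parity if and only if D₃ = {n/8}. -/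
open Complex Finset

noncomputable section

/-- The additive character `x ↦ exp (2πix)` of the rationals. -/
def ratExp (x : ℚ) : ℂ := Complex.exp (2 * Real.pi * Complex.I * x)

lemma ratExp_add (x y : ℚ) : ratExp (x + y) = ratExp x * ratExp y := by
  simp only [ratExp]
  rw [← Complex.exp_add]
  congr 1
  push_cast
  ring

lemma norm_ratExp (x : ℚ) : ‖ratExp x‖ = 1 := by
  have h : 2 * Real.pi * Complex.I * (x : ℂ) = ((2 * Real.pi * x : ℝ) : ℂ) * Complex.I := by
    push_cast
    ring
  rw [ratExp, h, Complex.norm_exp_ofReal_mul_I]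

lemma ratExp_eq_one_iff (x : ℚ) : ratExp x = 1 ↔ ∃ z : ℤ, x = z := by
  rw [ratExp, Complex.exp_eq_one_iff]
  refine exists_congr fun z => ?_
  rw [mul_comm, mul_left_inj' Complex.two_pi_I_ne_zero]
  exact_mod_cast Iff.rfl

lemma ratExp_intCast (z : ℤ) : ratExp z = 1 := (ratExp_eq_one_iff _).2 ⟨z, rfl⟩

lemma ratExp_half : ratExp (1 / 2) = -1 := by
  rw [ratExp, ← Complex.exp_pi_mul_I]
  congr 1
  push_cast
  ring

lemma ratExp_eq_of_sub_eq_int {x y : ℚ} (z : ℤ) (h : x - y = z) : ratExp x = ratExp y := by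
  rw [← sub_add_cancel x y, ratExp_add, h, ratExp_intCast, one_mul]

lemma ratExp_eq_neg_of_sub_eq {x y : ℚ} (z : ℤ) (h : x - y = z + 1 / 2) :
    ratExp x = -ratExp y := by
  rw [← sub_add_cancel x y, ratExp_add, h, ratExp_add, ratExp_intCast, ratExp_half]
  ring

lemma ratExp_nat_mul (k : ℕ) (x : ℚ) : ratExp (k * x) = ratExp x ^ k := by
  rw [ratExp, ratExp, ← Complex.exp_nat_mul]
  congr 1
  push_cast
  ring

lemma isIntegral_ratExp (x : ℚ) : IsIntegral ℤ (ratExp x) := by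
  refine IsIntegral.of_pow (n := x.den) x.den_pos ?_
  rw [← ratExp_nat_mul, Rat.den_mul_eq_num, ratExp_intCast]
  exact isIntegral_one

/-- A rational integer that is a multiple of `c` in the algebraic integers is a multiple of `c`. -/
lemma int_dvd_of_eq_mul_isIntegral {a c : ℤ} (hc : c ≠ 0) {z : ℂ} (hz : IsIntegral ℤ z)
    (h : (a : ℂ) = c * z) : c ∣ a := by
  have hc' : (c : ℂ) ≠ 0 := by exact_mod_cast hc
  have hz' : z = algebraMap ℚ ℂ (a / c) := by
    simp only [eq_ratCast]
    push_cast
    rw [h, mul_div_cancel_left₀ _ hc']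
  rw [hz', isIntegral_algebraMap_iff (algebraMap ℚ ℂ).injective,
    IsIntegrallyClosed.isIntegral_iff] at hz
  obtain ⟨y, hy⟩ := hz
  refine ⟨y, ?_⟩
  have hc'' : (c : ℚ) ≠ 0 := by exact_mod_cast hc
  simp only [eq_intCast] at hy
  rw [eq_div_iff hc''] at hy
  have : a = y * c := by exact_mod_cast hy.symm
  rw [this, mul_comm]

lemma sum_range_add_of_periodic {m : ℕ} {g : ℤ → ℂ} (hg : ∀ x, g (x + m) = g x) (s : ℤ) :
    ∑ k ∈ range m, g (k + s) = ∑ k ∈ range m, g k := by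
  have step : ∀ s : ℤ, ∑ k ∈ range m, g (k + (s + 1)) = ∑ k ∈ range m, g (k + s) := by
    intro s
    have h1 := Finset.sum_range_succ (fun k : ℕ => g (k + s)) m
    rw [Finset.sum_range_succ'] at h1
    have h2 : g ((m : ℤ) + s) = g (((0 : ℕ) : ℤ) + s) := by
      rw [add_comm, hg]
      simp
    rw [h2] at h1
    rw [← add_right_cancel h1]
    refine Finset.sum_congr rfl fun k _ => ?_
    congr 1
    push_cast
    ring
  induction s using Int.induction_on with
  | zero => simp
  | succ i ih => rw [step, ih]
  | pred i ih =>
    rw [← ih, ← step]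
    simp

lemma sum_range_sub_of_periodic {m : ℕ} {g : ℤ → ℂ} (hg : ∀ x, g (x + m) = g x) (s : ℤ) :
    ∑ k ∈ range m, g (s - k) = ∑ k ∈ range m, g k := by
  rw [← sum_range_add_of_periodic hg (s - m + 1), ← Finset.sum_range_reflect]
  refine Finset.sum_congr rfl fun k hk => ?_
  have := Finset.mem_range.1 hk
  congr 1
  omega

/-- The indicator of the integers congruent to `r` modulo `4` and coprime to `p`. -/
def residueInd (p r : ℕ) (x : ℤ) : ℂ := if x % 4 = r ∧ Int.gcd x p = 1 then 1 else 0

lemma residueInd_add (p r : ℕ) (x c : ℤ) :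
    residueInd p r (x + 4 * p * c) = residueInd p r x := by
  have h1 : (x + 4 * p * c) % 4 = x % 4 := by
    rw [mul_assoc]
    omega
  have h2 : Int.gcd (x + 4 * p * c) p = Int.gcd x p := by
    rw [show x + 4 * p * c = x + p * (4 * c) by ring]
    simp
  simp only [residueInd, h1, h2]

lemma residueInd_sub {p r : ℕ} (hp : Odd p) (hr : r = 1 ∨ r = 3) (x : ℤ) :
    residueInd p r (2 * p - x) = residueInd p r x := by
  have h1 : (2 * p - x) % 4 = r ↔ x % 4 = r := by
    obtain ⟨c, rfl⟩ := hp
    push_cast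
    omega
  have h2 : Int.gcd (2 * p - x) p = Int.gcd x p := by
    rw [show 2 * (p : ℤ) - x = -x + p * 2 by ring]
    simp
  simp only [residueInd, h1, h2]

/-- The contribution of a divisor `d` with `n / d = 2 ^ t * p` to the eigenvalue `μ_j`. -/
def divisorSum (t p r j : ℕ) : ℂ :=
  ∑ k ∈ range (2 ^ t * p), residueInd p r k *
    (ratExp (j * k / (2 ^ t * p)) - ratExp (-(j * k / (2 ^ t * p))))

/-- A quarter of the contribution of a divisor `d` with `n / d = 8 * p` to `μ_j / i`, for
`j ≡ 2 (mod 4)`. -/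
def quarterSum (p r j : ℕ) : ℂ :=
  ∑ k ∈ range (4 * p), residueInd p r k * ratExp (j * k / (8 * p))

lemma divisorSum_two {p r j : ℕ} (hp : Odd p) (hr : r = 1 ∨ r = 3) (hj : j % 4 = 2) :
    divisorSum 2 p r j = 0 := by
  have hp0 : (p : ℚ) ≠ 0 := by exact_mod_cast hp.pos.ne'
  obtain ⟨l, rfl⟩ : ∃ l, j = 4 * l + 2 := ⟨j / 4, by omega⟩
  set g : ℤ → ℂ := fun x => residueInd p r x *
    (ratExp ((4 * l + 2 : ℕ) * x / (2 ^ 2 * p)) - ratExp (-((4 * l + 2 : ℕ) * x / (2 ^ 2 * p))))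
    with hg
  have hper : ∀ x, g (x + (2 ^ 2 * p : ℕ)) = g x := by
    intro x
    have h0 : residueInd p r (x + (2 ^ 2 * p : ℕ)) = residueInd p r x := by
      rw [← residueInd_add p r x 1]
      congr 1
      push_cast
      ring
    simp only [hg, h0]
    congr 2
    · apply ratExp_eq_of_sub_eq_int (4 * l + 2)
      push_cast
      field_simp
      ring
    · apply ratExp_eq_of_sub_eq_int (-(4 * l + 2))
      push_cast
      field_simp
      ring
  have hneg : ∀ x, g (2 * p - x) = -g x := by
    intro x
    simp only [hg, residueInd_sub hp hr]
    rw [← mul_neg, neg_sub]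
    congr 2
    · apply ratExp_eq_of_sub_eq_int (2 * l + 1)
      push_cast
      field_simp
      ring
    · apply ratExp_eq_of_sub_eq_int (-(2 * l + 1))
      push_cast
      field_simp
      ring
  have h := sum_range_sub_of_periodic hper (2 * p)
  simp only [hneg, Finset.sum_neg_distrib] at h
  have h' : divisorSum 2 p r (4 * l + 2) = ∑ k ∈ range (2 ^ 2 * p), g k := by
    simp [divisorSum, hg]
  rw [h']
  exact self_eq_neg.1 h.symm

lemma divisorSum_of_four_le {t p r j : ℕ} (ht : 4 ≤ t) (hp : Odd p) (hj : j % 4 = 2) :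
    divisorSum t p r j = 0 := by
  have hp0 : (p : ℚ) ≠ 0 := by exact_mod_cast hp.pos.ne'
  obtain ⟨l, rfl⟩ : ∃ l, j = 4 * l + 2 := ⟨j / 4, by omega⟩
  obtain ⟨t, rfl⟩ : ∃ s, t = s + 4 := ⟨t - 4, by omega⟩
  set g : ℤ → ℂ := fun x => residueInd p r x *
    (ratExp ((4 * l + 2 : ℕ) * x / (2 ^ (t + 4) * p)) -
      ratExp (-((4 * l + 2 : ℕ) * x / (2 ^ (t + 4) * p)))) with hg
  have hneg : ∀ x, g (x + 4 * p * 2 ^ t) = -g x := by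
    intro x
    simp only [hg, residueInd_add]
    rw [← mul_neg, neg_sub']
    congr 2
    · apply ratExp_eq_neg_of_sub_eq l
      push_cast
      field_simp
      ring
    · apply ratExp_eq_neg_of_sub_eq (-l - 1)
      push_cast
      field_simp
      ring
  have hper : ∀ x, g (x + (2 ^ (t + 4) * p : ℕ)) = g x := by
    intro x
    have : x + (2 ^ (t + 4) * p : ℕ) = x + 4 * p * 2 ^ t + 4 * p * 2 ^ t + 4 * p * 2 ^ t
        + 4 * p * 2 ^ t := by
      push_cast
      ring
    simp only [this, hneg, neg_neg]
  have h := sum_range_add_of_periodic hper (4 * p * 2 ^ t)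
  simp only [hneg, Finset.sum_neg_distrib] at h
  have h' : divisorSum (t + 4) p r (4 * l + 2) = ∑ k ∈ range (2 ^ (t + 4) * p), g k := by
    simp [divisorSum, hg]
  rw [h']
  exact self_eq_neg.1 h.symm

lemma divisorSum_three {p r j : ℕ} (hp : Odd p) (hr : r = 1 ∨ r = 3) (hj : j % 4 = 2) :
    divisorSum 3 p r j = 4 * quarterSum p r j := by
  have hp0 : (p : ℚ) ≠ 0 := by exact_mod_cast hp.pos.ne'
  obtain ⟨l, rfl⟩ : ∃ l, j = 4 * l + 2 := ⟨j / 4, by omega⟩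
  set g : ℤ → ℂ := fun x => residueInd p r x * ratExp ((4 * l + 2 : ℕ) * x / (8 * p)) with hg
  have hshift : ∀ x, g (x + 4 * p) = g x := by
    intro x
    have h0 : residueInd p r (x + 4 * p) = residueInd p r x := by
      simpa using residueInd_add p r x 1
    simp only [hg, h0]
    congr 1
    apply ratExp_eq_of_sub_eq_int (2 * l + 1)
    push_cast
    field_simp
    ring
  have hper : ∀ x, g (x + (2 ^ 3 * p : ℕ)) = g x := by
    intro x
    rw [show x + (2 ^ 3 * p : ℕ) = x + 4 * p + 4 * p by push_cast; ring, hshift, hshift]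
  have hrefl : ∀ x, g (2 * p - x) =
      -(residueInd p r x * ratExp (-((4 * l + 2 : ℕ) * x / (8 * p)))) := by
    intro x
    simp only [hg, residueInd_sub hp hr]
    rw [← mul_neg]
    congr 1
    apply ratExp_eq_neg_of_sub_eq l
    push_cast
    field_simp
    ring
  have h := sum_range_sub_of_periodic hper (2 * p)
  simp only [hrefl, Finset.sum_neg_distrib] at h
  have h1 : divisorSum 3 p r (4 * l + 2) = 2 * ∑ k ∈ range (2 ^ 3 * p), g k := by
    rw [two_mul]
    nth_rewrite 2 [← h]
    rw [← sub_eq_add_neg, ← Finset.sum_sub_distrib, divisorSum]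
    refine Finset.sum_congr rfl fun k _ => ?_
    simp only [hg, mul_sub]
    norm_num
  have h2 : ∑ k ∈ range (2 ^ 3 * p), g k = 2 * quarterSum p r (4 * l + 2) := by
    rw [show 2 ^ 3 * p = 4 * p + 4 * p by ring, Finset.sum_range_add, two_mul]
    have h3 : ∑ k ∈ range (4 * p), g k = quarterSum p r (4 * l + 2) := by
      simp [quarterSum, hg]
    rw [← h3]
    congr 1
    · refine Finset.sum_congr rfl fun k _ => ?_
      rw [show ((4 * p + k : ℕ) : ℤ) = (k : ℤ) + 4 * p by push_cast; ring, hshift]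
  rw [h1, h2]
  ring

lemma gcd_two_pow_mul_eq_one_iff {t p k : ℕ} (hk : Odd k) :
    Nat.gcd k (2 ^ t * p) = 1 ↔ Nat.gcd k p = 1 := by
  have h2 : Nat.Coprime k (2 ^ t) := (Nat.coprime_two_right.2 hk).pow_right t
  exact ⟨fun h => (Nat.coprime_mul_iff_right.1 h).2, fun h => Nat.coprime_mul_iff_right.2 ⟨h2, h⟩⟩

lemma residueInd_natCast (p r k : ℕ) :
    residueInd p r k = if k % 4 = r ∧ Nat.gcd k p = 1 then 1 else 0 := by
  have h : (k : ℤ) % 4 = r ↔ k % 4 = r := by omega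
  simp only [residueInd, h, Int.gcd_natCast_natCast]

lemma sum_Gsetr {n d t p r : ℕ} (hr : r = 1 ∨ r = 3) (hd : 0 < d)
    (hn : n = d * (2 ^ t * p)) (F : ℕ → ℂ) :
    ∑ a ∈ Gsetr n r d, F a = ∑ k ∈ range (2 ^ t * p), residueInd p r k * F (d * k) := by
  simp only [residueInd_natCast, ite_mul, one_mul, zero_mul]
  rw [← Finset.sum_filter]
  have hodd : ∀ k, k % 4 = r → Odd k := fun k hk => Nat.odd_iff.2 (by omega)
  subst hn
  refine Finset.sum_nbij' (fun a => a / d) (fun k => d * k) ?_ ?_ ?_ ?_ ?_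
  · intro a ha
    simp only [Gsetr, Finset.mem_filter, Finset.mem_range] at ha ⊢
    obtain ⟨ha, ⟨k, rfl⟩, hk, hg⟩ := ha
    rw [Nat.mul_div_cancel_left _ hd] at hk ⊢
    refine ⟨Nat.lt_of_mul_lt_mul_left ha, hk, ?_⟩
    rw [← gcd_two_pow_mul_eq_one_iff (hodd k hk)]
    rw [Nat.gcd_mul_left] at hg
    exact Nat.eq_of_mul_eq_mul_left hd (by rw [hg, mul_one])
  · intro k hk
    simp only [Gsetr, Finset.mem_filter, Finset.mem_range] at hk ⊢
    obtain ⟨hk, hk4, hg⟩ := hk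
    rw [Nat.mul_div_cancel_left _ hd, Nat.gcd_mul_left,
      (gcd_two_pow_mul_eq_one_iff (hodd k hk4)).2 hg, mul_one]
    exact ⟨Nat.mul_lt_mul_of_pos_left hk hd, dvd_mul_right _ _, hk4, rfl⟩
  · intro a ha
    simp only [Gsetr, Finset.mem_filter] at ha
    exact Nat.mul_div_cancel' ha.2.1
  · intro k _
    exact Nat.mul_div_cancel_left _ hd
  · intro a ha
    simp only [Gsetr, Finset.mem_filter] at ha
    rw [Nat.mul_div_cancel' ha.2.1]

lemma exists_eq_mul_two_pow_mul_odd {n d : ℕ} (hn : n ≠ 0) (hn4 : 4 ∣ n) (hd : d ∣ n / 4) :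
    ∃ t p, 2 ≤ t ∧ Odd p ∧ 0 < d ∧ n = d * (2 ^ t * p) ∧ padicValNat 2 (n / d) = t := by
  obtain ⟨m, hm⟩ := hd
  have hn' : n = d * (4 * m) := by
    rw [← Nat.mul_div_cancel' hn4, hm]
    ring
  have hm0 : m ≠ 0 := by
    rintro rfl
    simp_all
  have hd0 : 0 < d := by
    rcases Nat.eq_zero_or_pos d with rfl | h
    · simp_all
    · exact h
  obtain ⟨t, p, hp, rfl⟩ := Nat.exists_eq_two_pow_mul_odd hm0
  have hn'' : n = d * (2 ^ (t + 2) * p) := by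
    rw [hn']
    ring
  refine ⟨t + 2, p, by omega, hp, hd0, hn'', ?_⟩
  rw [hn'', Nat.mul_div_cancel_left _ hd0, padicValNat.mul (by positivity) hp.pos.ne',
    padicValNat.prime_pow, padicValNat.eq_zero_of_not_dvd hp.not_two_dvd_nat, add_zero]

lemma sum_Gsetr_exp {n d t p r j : ℕ} (hp : Odd p) (hr : r = 1 ∨ r = 3)
    (hd : 0 < d) (hn : n = d * (2 ^ t * p)) :
    ∑ k ∈ Gsetr n r d, (Complex.exp (2 * Real.pi * Complex.I * j * k / n) -
      Complex.exp (-(2 * Real.pi * Complex.I * j * k / n))) = divisorSum t p r j := by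
  rw [sum_Gsetr hr hd hn, divisorSum]
  have hp0 : (p : ℂ) ≠ 0 := by exact_mod_cast hp.pos.ne'
  have hd0 : (d : ℂ) ≠ 0 := by exact_mod_cast hd.ne'
  refine Finset.sum_congr rfl fun k _ => ?_
  have h : 2 * Real.pi * Complex.I * j * (d * k : ℕ) / n =
      2 * Real.pi * Complex.I * ((j * k / (2 ^ t * p) : ℚ) : ℂ) := by
    rw [hn]
    push_cast
    field_simp
  simp only [ratExp, h]
  congr 3
  push_cast
  ring

lemma eigval_symbol_s16 {n : ℕ} (hn : n ≠ 0) (hn4 : 4 ∣ n) {D : Finset ℕ}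
    (hD : ∀ d ∈ D, d ∣ n / 4) (σ : ℕ → ℤ) {j : ℕ} (hj : j % 4 = 2) :
    eigval n (symbol n D σ) j = 4 * (Complex.I *
      ∑ d ∈ D.filter (fun d => padicValNat 2 (n / d) = 3),
        quarterSum (n / d / 8) (if σ d = 1 then 1 else 3) j) := by
  rw [eigval, symbol, Finset.sum_biUnion, Finset.sum_filter]
  · rw [mul_left_comm, Finset.mul_sum _ _ (4 : ℂ)]
    congr 1
    refine Finset.sum_congr rfl fun d hd => ?_
    obtain ⟨t, p, ht, hp, hd0, hn', hv⟩ := exists_eq_mul_two_pow_mul_odd hn hn4 (hD d hd)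
    have hr : (if σ d = 1 then 1 else 3) = 1 ∨ (if σ d = 1 then 1 else 3) = 3 := by
      split_ifs <;> simp
    rw [sum_Gsetr_exp hp hr hd0 hn', hv]
    rcases (by omega : t = 2 ∨ t = 3 ∨ 4 ≤ t) with rfl | rfl | h
    · simp [divisorSum_two hp hr hj]
    · rw [divisorSum_three hp hr hj, if_pos rfl, hn', Nat.mul_div_cancel_left _ hd0]
      congr 2
      omega
    · rw [divisorSum_of_four_le h hp hj, if_neg (by omega), mul_zero]
  · intro d₁ _ d₂ _ hne
    refine Finset.disjoint_left.2 fun a h1 h2 => hne ?_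
    simp only [Gsetr, Finset.mem_filter] at h1 h2
    exact h1.2.2.2.symm.trans h2.2.2.2

lemma isIntegral_quarterSum (p r j : ℕ) : IsIntegral ℤ (quarterSum p r j) := by
  refine IsIntegral.sum _ fun k _ => IsIntegral.mul ?_ (isIntegral_ratExp _)
  rw [residueInd]
  split_ifs
  · exact isIntegral_one
  · exact isIntegral_zero

open Classical in
lemma sum_ratExp_pow {N : ℕ} {x : ℚ} (hx : ∃ z : ℤ, N * x = z) :
    ∑ q ∈ range N, ratExp x ^ q = if ∃ z : ℤ, x = z then (N : ℂ) else 0 := by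
  split_ifs with h
  · simp [(ratExp_eq_one_iff x).2 h]
  · have h1 : ratExp x ≠ 1 := fun h' => h ((ratExp_eq_one_iff x).1 h')
    have h2 : ratExp x ^ N = 1 := by
      rw [← ratExp_nat_mul, ratExp_eq_one_iff]
      exact hx
    rw [geom_sum_eq h1, h2]
    simp

lemma exists_int_mul_div {N p : ℕ} (hp : 0 < p) (h : p ∣ N) (k : ℕ) :
    ∃ z : ℤ, (N : ℚ) * (k / p) = z := by
  obtain ⟨c, rfl⟩ := h
  have hp0 : (p : ℚ) ≠ 0 := by exact_mod_cast hp.ne'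
  refine ⟨c * k, ?_⟩
  push_cast
  field_simp

open Classical in
lemma sum_quarterSum_mul_ratExp {p r p₀ k₀ N : ℕ} (hp : 0 < p) (hp₀ : 0 < p₀) (hN : p ∣ N)
    (hN₀ : p₀ ∣ N) :
    ∑ q ∈ range N, quarterSum p r (2 + 8 * q) * ratExp (-(k₀ / p₀)) ^ q =
      ∑ k ∈ range (4 * p), residueInd p r k * ratExp (k / (4 * p)) *
        if ∃ z : ℤ, (k / p - k₀ / p₀ : ℚ) = z then (N : ℂ) else 0 := by
  have hp0 : (p : ℚ) ≠ 0 := by exact_mod_cast hp.ne'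
  simp only [quarterSum, Finset.sum_mul]
  rw [Finset.sum_comm]
  refine Finset.sum_congr rfl fun k _ => ?_
  rw [← sum_ratExp_pow, Finset.mul_sum]
  · refine Finset.sum_congr rfl fun q _ => ?_
    simp only [← ratExp_nat_mul, mul_assoc, ← ratExp_add]
    congr 2
    push_cast
    field_simp
    ring
  · obtain ⟨a, ha⟩ := exists_int_mul_div hp hN k
    obtain ⟨b, hb⟩ := exists_int_mul_div hp₀ hN₀ k₀
    exact ⟨a - b, by rw [mul_sub, ha, hb]; push_cast; ring⟩

/-- Two reduced fractions that differ by an integer have the same denominator. -/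
lemma den_eq_of_sub_eq_int {k p k₀ p₀ : ℕ} (hp : 0 < p) (hp₀ : 0 < p₀) (h : Nat.gcd k p = 1)
    (h₀ : Nat.gcd k₀ p₀ = 1) {z : ℤ} (hz : (k / p - k₀ / p₀ : ℚ) = z) : p = p₀ := by
  have hp0 : (p : ℚ) ≠ 0 := by exact_mod_cast hp.ne'
  have hp0' : (p₀ : ℚ) ≠ 0 := by exact_mod_cast hp₀.ne'
  have hz' : (k : ℤ) * p₀ - k₀ * p = z * (p * p₀) := by
    field_simp at hz
    have : (k : ℚ) * p₀ - k₀ * p = z * (p * p₀) := by linarith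
    exact_mod_cast this
  have c1 : IsCoprime (p : ℤ) k := Nat.isCoprime_iff_coprime.2 (Nat.Coprime.symm h)
  have c2 : IsCoprime (p₀ : ℤ) k₀ := Nat.isCoprime_iff_coprime.2 (Nat.Coprime.symm h₀)
  have d1 : (p : ℤ) ∣ p₀ := c1.dvd_of_dvd_mul_left ⟨k₀ + z * p₀, by linear_combination hz'⟩
  have d2 : (p₀ : ℤ) ∣ p := c2.dvd_of_dvd_mul_left ⟨k - z * p, by linear_combination -hz'⟩
  exact Nat.dvd_antisymm (by exact_mod_cast d1) (by exact_mod_cast d2)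

lemma sum_quarterSum_mul_ratExp_of_ne {p r p₀ k₀ N : ℕ} (hp : 0 < p) (hp₀ : 0 < p₀)
    (hN : p ∣ N) (hN₀ : p₀ ∣ N) (h₀ : Nat.gcd k₀ p₀ = 1) (hne : p ≠ p₀) :
    ∑ q ∈ range N, quarterSum p r (2 + 8 * q) * ratExp (-(k₀ / p₀)) ^ q = 0 := by
  rw [sum_quarterSum_mul_ratExp hp hp₀ hN hN₀]
  refine Finset.sum_eq_zero fun k _ => ?_
  rw [residueInd_natCast]
  split_ifs with h1 h2
  · obtain ⟨z, hz⟩ := h2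
    exact absurd (den_eq_of_sub_eq_int hp hp₀ h1.2 h₀ hz) hne
  all_goals simp

lemma sum_quarterSum_mul_ratExp_self {p r k₀ N : ℕ} (hp : Odd p) (hN : p ∣ N)
    (h₀ : Nat.gcd k₀ p = 1) (hk₀ : k₀ < 4 * p) (hr : k₀ % 4 = r) :
    ∑ q ∈ range N, quarterSum p r (2 + 8 * q) * ratExp (-(k₀ / p)) ^ q =
      N * ratExp (k₀ / (4 * p)) := by
  have hp0 : (p : ℚ) ≠ 0 := by exact_mod_cast hp.pos.ne'
  rw [sum_quarterSum_mul_ratExp hp.pos hp.pos hN hN, Finset.sum_eq_single k₀]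
  · rw [residueInd_natCast, if_pos ⟨hr, h₀⟩, if_pos ⟨0, by simp⟩]
    ring
  · intro k hk hne
    rw [residueInd_natCast]
    split_ifs with h1 h2
    · exfalso
      obtain ⟨z, hz⟩ := h2
      field_simp at hz
      have hz' : (k : ℤ) - k₀ = p * z := by exact_mod_cast hz
      have h4 : (4 : ℤ) ∣ p * z := by
        rw [← hz']
        omega
      have hc : IsCoprime (4 : ℤ) p := by
        have : Nat.Coprime (2 ^ 2) p := (Nat.coprime_two_left.2 hp).pow_left 2
        exact_mod_cast Nat.isCoprime_iff_coprime.2 this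
      obtain ⟨w, rfl⟩ := hc.dvd_of_dvd_mul_left h4
      have hlt := Finset.mem_range.1 hk
      have hw : w = 0 := by
        have hpos : (0 : ℤ) < 4 * p := by have := hp.pos; positivity
        have a1 : 4 * (p : ℤ) * w < 4 * p * 1 := by nlinarith
        have a2 : 4 * (p : ℤ) * (-1) < 4 * p * w := by nlinarith
        have b1 := lt_of_mul_lt_mul_left a1 hpos.le
        have b2 := lt_of_mul_lt_mul_left a2 hpos.le
        omega
      subst hw
      simp at hz'
      omega
    all_goals simp
  · intro h
    exact absurd (Finset.mem_range.2 hk₀) h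

lemma quarterSum_one {r : ℕ} (hr : r = 1 ∨ r = 3) (j : ℕ) :
    quarterSum 1 r j = ratExp (j * r / 8) := by
  rcases hr with rfl | rfl <;>
    simp [quarterSum, residueInd, Finset.sum_range_succ]

lemma exists_residue {p r : ℕ} (hp : 0 < p) (hr : r = 1 ∨ r = 3) :
    ∃ k < 4 * p, k % 4 = r ∧ Nat.gcd k p = 1 := by
  rcases hr with rfl | rfl
  · exact ⟨1, by omega, rfl, Nat.gcd_one_left p⟩
  · refine ⟨4 * p - 1, by omega, by omega, ?_⟩
    have h : Nat.Coprime (4 * p - 1) (4 * p - 1 + 1) := by simp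
    rw [Nat.sub_add_cancel (by omega)] at h
    exact h.coprime_mul_left_right

theorem parity_iff_D3 (n : ℕ) [NeZero n] (hn4 : 4 ∣ n)
    (D : Finset ℕ) (hD : ∀ d ∈ D, d ∣ n / 4)
    (σ : ℕ → ℤ) (hσ : ∀ d ∈ D, σ d = 1 ∨ σ d = -1)
    (μ : ℕ → ℤ) (hμ : ∀ j < n, (μ j : ℂ) = eigval n (symbol n D σ) j)
    (hD3 : (D.filter (fun d => padicValNat 2 (n / d) = 3)).Nonempty) :
    (∀ j < n, j % 4 = 2 → (4 : ℤ) ∣ μ j) ∧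
    ((∀ j₁ < n, ∀ j₂ < n, j₁ % 4 = 2 → j₂ % 4 = 2 →
        (μ j₁ / 4) % 2 = (μ j₂ / 4) % 2) ↔
      D.filter (fun d => padicValNat 2 (n / d) = 3) = {n / 8}) := by
  have hn0 : n ≠ 0 := NeZero.ne n
  set D₃ := D.filter (fun d => padicValNat 2 (n / d) = 3) with hD₃
  set r : ℕ → ℕ := fun d => if σ d = 1 then 1 else 3 with hr_def
  have hr : ∀ d, r d = 1 ∨ r d = 3 := by
    intro d
    simp only [hr_def]
    split_ifs <;> simp
  have hdec : ∀ d ∈ D₃, Odd (n / d / 8) ∧ 0 < d ∧ n = d * (8 * (n / d / 8)) := by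
    intro d hd
    rw [hD₃, Finset.mem_filter] at hd
    obtain ⟨t, p, -, hp, hd0, hn, hv⟩ := exists_eq_mul_two_pow_mul_odd hn0 hn4 (hD d hd.1)
    obtain rfl : t = 3 := by rw [← hv, hd.2]
    have h : n / d / 8 = p := by
      rw [hn, Nat.mul_div_cancel_left _ hd0]
      omega
    rw [h]
    exact ⟨hp, hd0, hn⟩
  set F : ℕ → ℂ := fun j => ∑ d ∈ D₃, quarterSum (n / d / 8) (r d) j with hF
  have hFint : ∀ j, IsIntegral ℤ (F j) := fun j =>
    IsIntegral.sum _ fun d _ => isIntegral_quarterSum _ _ _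
  have hIint : IsIntegral ℤ Complex.I := by
    refine IsIntegral.of_pow (n := 4) (by norm_num) ?_
    rw [Complex.I_pow_four]
    exact isIntegral_one
  have hμF : ∀ j < n, j % 4 = 2 → (μ j : ℂ) = 4 * (Complex.I * F j) := fun j hj hj4 => by
    rw [hμ j hj, eigval_symbol_s16 hn0 hn4 hD σ hj4]
  have hdvd : ∀ j < n, j % 4 = 2 → (4 : ℤ) ∣ μ j := fun j hj hj4 =>
    int_dvd_of_eq_mul_isIntegral (by norm_num) (hIint.mul (hFint j))
      (by rw [hμF j hj hj4]; norm_num)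
  have hν : ∀ j < n, j % 4 = 2 → ((μ j / 4 : ℤ) : ℂ) = Complex.I * F j := by
    intro j hj hj4
    have h := hμF j hj hj4
    rw [← Int.mul_ediv_cancel' (hdvd j hj hj4)] at h
    push_cast at h
    exact mul_left_cancel₀ (by norm_num) h
  refine ⟨hdvd, fun hpar => ?_, fun hsing => ?_⟩
  · refine Finset.eq_singleton_iff_nonempty_unique_mem.2 ⟨hD3, fun d₀ hd₀ => ?_⟩
    obtain ⟨hp₀, hd₀0, hn₀⟩ := hdec d₀ hd₀
    set p₀ := n / d₀ / 8 with hp₀_def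
    by_contra hne
    have hp₀1 : p₀ ≠ 1 := by
      intro h
      rw [h] at hn₀
      omega
    obtain ⟨K, N, hN, hnN⟩ := Nat.exists_eq_two_pow_mul_odd hn0
    have hpN : ∀ d ∈ D₃, n / d / 8 ∣ N := by
      intro d hd
      obtain ⟨hp, -, hn⟩ := hdec d hd
      refine ((Nat.coprime_two_right.2 hp).pow_right K).dvd_of_dvd_mul_left ?_
      rw [← hnN]
      exact ⟨d * 8, by linarith⟩
    have h8N : 8 * N ≤ n := by
      have h8 : Nat.Coprime N (2 ^ 3) := (Nat.coprime_two_right.2 hN).pow_right 3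
      have h8n : 8 ∣ n := ⟨d₀ * p₀, by linarith⟩
      have hNn : N ∣ n := ⟨2 ^ K, by rw [hnN, mul_comm]⟩
      have := Nat.Coprime.mul_dvd_of_dvd_of_dvd h8.symm h8n hNn
      exact Nat.le_of_dvd (Nat.pos_of_ne_zero hn0) this
    have hlt : ∀ q ∈ range N, 2 + 8 * q < n := fun q hq => by
      have := Finset.mem_range.1 hq
      omega
    have h2n : 2 < n := by
      have := hN.pos
      omega
    obtain ⟨k₀, hk₀, hk₀4, hg⟩ := exists_residue hp₀.pos (hr d₀)
    set w := ratExp (-(k₀ / p₀)) with hw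
    have hw0 : ∑ q ∈ range N, w ^ q = 0 := by
      rw [hw, sum_ratExp_pow, if_neg]
      · rintro ⟨z, hz⟩
        refine hp₀1 (den_eq_of_sub_eq_int (k := 0) (p := 1) (z := z) one_pos hp₀.pos rfl hg ?_).symm
        rw [← hz]
        simp
      · obtain ⟨z, hz⟩ := exists_int_mul_div hp₀.pos (hpN d₀ hd₀) k₀
        exact ⟨-z, by rw [mul_neg, hz]; push_cast; rfl⟩
    have hFw : ∑ q ∈ range N, F (2 + 8 * q) * w ^ q = N * ratExp (k₀ / (4 * p₀)) := by
      simp only [hF, Finset.sum_mul]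
      rw [Finset.sum_comm, Finset.sum_eq_single_of_mem d₀ hd₀]
      · exact sum_quarterSum_mul_ratExp_self hp₀ (hpN d₀ hd₀) hg hk₀ hk₀4
      · intro d hd hdd
        obtain ⟨hp, hd0, hn⟩ := hdec d hd
        refine sum_quarterSum_mul_ratExp_of_ne hp.pos hp₀.pos (hpN d hd) (hpN d₀ hd₀) hg ?_
        intro hpp
        rw [hpp, hn₀] at hn
        exact hdd (Nat.eq_of_mul_eq_mul_right (by have := hp₀.pos; omega) hn).symm
    have hν2 : ∀ q ∈ range N, Complex.I * F (2 + 8 * q) =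
        (μ 2 / 4 : ℤ) + 2 * (((μ (2 + 8 * q) / 4 - μ 2 / 4) / 2 : ℤ) : ℂ) := by
      intro q hq
      rw [← hν _ (hlt q hq) (by omega)]
      have h := hpar (2 + 8 * q) (hlt q hq) 2 h2n (by omega) rfl
      have h' : μ (2 + 8 * q) / 4 = μ 2 / 4 + 2 * ((μ (2 + 8 * q) / 4 - μ 2 / 4) / 2) := by omega
      exact_mod_cast h'
    set Z : ℂ := ∑ q ∈ range N, (((μ (2 + 8 * q) / 4 - μ 2 / 4) / 2 : ℤ) : ℂ) * w ^ q with hZ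
    have hZint : IsIntegral ℤ Z := IsIntegral.sum _ fun q _ =>
      (isIntegral_algebraMap (R := ℤ) (A := ℂ)).mul ((isIntegral_ratExp _).pow q)
    have hsum : Complex.I * (N * ratExp (k₀ / (4 * p₀))) = 2 * Z := by
      calc Complex.I * (N * ratExp (k₀ / (4 * p₀)))
          = ∑ q ∈ range N, Complex.I * F (2 + 8 * q) * w ^ q := by
            rw [← hFw, Finset.mul_sum]
            exact Finset.sum_congr rfl fun q _ => (mul_assoc _ _ _).symm
        _ = ((μ 2 / 4 : ℤ) : ℂ) * ∑ q ∈ range N, w ^ q + 2 * Z := by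
            rw [hZ, Finset.mul_sum, Finset.mul_sum, ← Finset.sum_add_distrib]
            refine Finset.sum_congr rfl fun q hq => ?_
            rw [hν2 q hq]
            ring
        _ = 2 * Z := by rw [hw0, mul_zero, zero_add]
    have hinv : ratExp (k₀ / (4 * p₀)) * ratExp (-(k₀ / (4 * p₀))) = 1 := by
      rw [← ratExp_add, add_neg_cancel]
      exact_mod_cast ratExp_intCast 0
    have h2N : (2 : ℤ) ∣ N := by
      refine int_dvd_of_eq_mul_isIntegral (by norm_num)
        ((hZint.mul (isIntegral_ratExp (-(k₀ / (4 * p₀))))).mul hIint.neg) ?_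
      push_cast
      linear_combination (-Complex.I * ratExp (-(k₀ / (4 * p₀)))) * hsum - N * hinv
        + N * ratExp (k₀ / (4 * p₀)) * ratExp (-(k₀ / (4 * p₀))) * Complex.I_mul_I
    obtain ⟨c, rfl⟩ := hN
    omega
  · have hmem : n / 8 ∈ D₃ := by simp [hsing]
    obtain ⟨-, hd0, hn⟩ := hdec _ hmem
    have hp : n / (n / 8) / 8 = 1 := by
      have h1 : 8 * (n / 8) ≤ n := Nat.mul_div_le n 8
      have h8 : 8 ∣ n := ⟨n / 8 * (n / (n / 8) / 8), by linarith⟩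
      have h2 : n / 8 * 8 = n := Nat.div_mul_cancel h8
      have h3 : n / 8 * (8 * (n / (n / 8) / 8)) = n / 8 * 8 := by rw [← hn, h2]
      have := Nat.eq_of_mul_eq_mul_left hd0 h3
      omega
    have hunit : ∀ j < n, j % 4 = 2 → μ j / 4 = 1 ∨ μ j / 4 = -1 := by
      intro j hj hj4
      have h := hν j hj hj4
      simp only [hF, hsing, Finset.sum_singleton, hp] at h
      rw [quarterSum_one (hr _)] at h
      have h' := congrArg norm h
      rw [norm_mul, norm_ratExp, Complex.norm_I, Complex.norm_intCast, mul_one] at h'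
      have h'' : |μ j / 4| = 1 := by exact_mod_cast h'
      exact eq_or_eq_neg_of_abs_eq h''
    intro j₁ h₁ j₂ h₂ h₁4 h₂4
    have a₁ := hunit j₁ h₁ h₁4
    have a₂ := hunit j₂ h₂ h₂4
    omega

end
end

section
/- Let n ≥ 4 be a positive integer divisible by 4 and let Γ = IOCG_n(D,σ) be an integral oriented circulant graph. Then Γ does not have universal state transfer; that is, it is not the case that Γ has perfect state transfer between every pair of distinct vertices of Z_n. -/
open Complex Finset

noncomputable section

open scoped Matrix

theorem Gsetr_neg_notMem {n d r : ℕ} [NeZero n] (hd : 4 * d ∣ n) (hr : r = 1 ∨ r = 3)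
    {x : ZMod n} (hx : x.val ∈ Gsetr n r d) : (-x).val ∉ Gsetr n r d := by
  simp only [Gsetr, Finset.mem_filter] at hx ⊢
  rintro ⟨-, ⟨b, hb⟩, hbr, -⟩
  obtain ⟨-, ⟨a, ha⟩, har, -⟩ := hx
  obtain ⟨m, hm⟩ := hd
  have hn : 0 < n := Nat.pos_of_neZero n
  have hd0 : 0 < d := by
    rcases Nat.eq_zero_or_pos d with rfl | h
    · simp at hm; omega
    · exact h
  rw [ha, Nat.mul_div_cancel_left _ hd0] at har
  rw [hb, Nat.mul_div_cancel_left _ hd0] at hbr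
  have hx0 : x ≠ 0 := by
    rintro rfl
    rw [ZMod.val_zero, eq_comm, Nat.mul_eq_zero] at ha
    omega
  have hsum : x.val + (-x).val = n := by
    have : NeZero x := ⟨hx0⟩
    rw [ZMod.val_neg_of_ne_zero]
    have := x.val_lt
    omega
  rw [ha, hb, hm, ← mul_add, mul_comm 4 d, mul_assoc] at hsum
  have := Nat.eq_of_mul_eq_mul_left hd0 hsum
  omega

theorem symbol_neg_notMem {n : ℕ} [NeZero n] (hn4 : 4 ∣ n) {D : Finset ℕ}
    (hD : ∀ d ∈ D, d ∣ n / 4) (σ : ℕ → ℤ) {x : ZMod n} (hx : x.val ∈ symbol n D σ) :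
    (-x).val ∉ symbol n D σ := by
  simp only [symbol, Finset.mem_biUnion] at hx ⊢
  rintro ⟨e, he, hxe⟩
  obtain ⟨d, hd, hxd⟩ := hx
  have hgcd : Nat.gcd (-x).val n = Nat.gcd x.val n := by
    rw [ZMod.neg_val]
    split_ifs with h
    · simp [h]
    · rw [Nat.gcd_comm, Nat.gcd_self_sub_right x.val_lt.le, Nat.gcd_comm]
  have hde : e = d := by
    simp only [Gsetr, Finset.mem_filter] at hxe hxd
    rw [← hxe.2.2.2, hgcd, hxd.2.2.2]
  subst hde
  refine Gsetr_neg_notMem ?_ (by split_ifs <;> simp) hxd hxe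
  obtain ⟨m, rfl⟩ := hn4
  exact mul_dvd_mul_left 4 (by simpa using hD e he)

theorem Matrix.mul_exp_of_mul_eq_zero {m : Type*} [Fintype m] [DecidableEq m]
    {M A : Matrix m m ℂ} (h : M * A = 0) : M * NormedSpace.exp A = M := by
  have hs : SemiconjBy M A 0 := by simpa [SemiconjBy] using h
  have he : M * NormedSpace.exp A = NormedSpace.exp 0 * M :=
    open scoped Matrix.Norms.Operator in hs.exp_right
  rw [he, NormedSpace.exp_zero, one_mul]

theorem Matrix.vecMul_exp_of_vecMul_eq_zero {m : Type*} [Fintype m] [DecidableEq m]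
    {w : m → ℂ} {A : Matrix m m ℂ} (h : w ᵥ* A = 0) : w ᵥ* NormedSpace.exp A = w := by
  have hM : Matrix.of (fun _ : m => w) * A = 0 := by
    ext i j
    exact congrFun h j
  ext j
  exact congrFun (congrFun (Matrix.mul_exp_of_mul_eq_zero hM) j) j

theorem AddChar.vecMul_hermMatrix {n : ℕ} [NeZero n] {C : Finset ℕ}
    (hC : ∀ x : ZMod n, x.val ∈ C → (-x).val ∉ C) (f : AddChar (ZMod n) ℂ)
    (hf : ∀ x, f (-x) = f x) : f ᵥ* hermMatrix n C = 0 := by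
  ext v
  set h : ZMod n → ℂ := fun x =>
    if x.val ∈ C then Complex.I else if (-x).val ∈ C then -Complex.I else 0 with hh
  have hodd : ∀ x, h (-x) = -h x := by
    intro x
    have := hC x
    simp only [hh, neg_neg]
    split_ifs <;> simp_all
  have hsum : ∑ x, f x * h x = 0 := by
    have : ∑ x, f x * h x = -∑ x, f x * h x := by
      rw [← Finset.sum_neg_distrib, ← Equiv.sum_comp (Equiv.neg (ZMod n))]
      simp [hf, hodd]
    exact self_eq_neg.mp this
  calc ∑ u, f u * hermMatrix n C u v = ∑ x, f v * (f x * h x) := by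
        rw [← Equiv.sum_comp (Equiv.subLeft v)]
        refine Finset.sum_congr rfl fun x _ => ?_
        simp [hermMatrix, hh, sub_eq_add_neg, AddChar.map_add_eq_mul, hf, mul_assoc]
    _ = 0 := by rw [← Finset.mul_sum, hsum, mul_zero]

theorem AddChar.eq_of_hasPST {n : ℕ} [NeZero n] {C : Finset ℕ}
    (hC : ∀ x : ZMod n, x.val ∈ C → (-x).val ∉ C) {f : AddChar (ZMod n) ℂ}
    (hf : ∀ x, f (-x) = f x) {u v : ZMod n} (h : hasPST n C u v) : f u = f v := by
  obtain ⟨t, γ, -, h⟩ := h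
  have key : ∀ g : AddChar (ZMod n) ℂ, (∀ x, g (-x) = g x) → g u = γ * g v := by
    intro g hg
    have hU : g ᵥ* transitionMatrix n C t = g :=
      Matrix.vecMul_exp_of_vecMul_eq_zero
        (by rw [Matrix.vecMul_smul, g.vecMul_hermMatrix hC hg, smul_zero])
    have hg' : g ⬝ᵥ (transitionMatrix n C t *ᵥ Pi.single u 1) = g ⬝ᵥ (γ • Pi.single v 1) :=
      congrArg (g ⬝ᵥ ·) h
    rw [Matrix.dotProduct_mulVec, hU] at hg'
    simpa using hg'
  have hγ : γ = 1 := by simpa using (key 1 (by simp)).symm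
  simpa [hγ] using key f hf

theorem no_ust (n : ℕ) [NeZero n] (hn : 4 ≤ n) (hn4 : 4 ∣ n)
    (D : Finset ℕ) (hD : ∀ d ∈ D, d ∣ n / 4)
    (σ : ℕ → ℤ) (hσ : ∀ d ∈ D, σ d = 1 ∨ σ d = -1) :
    ¬ ∀ u v : ZMod n, u ≠ v → hasPST n (symbol n D σ) u v := by
  have hC := fun x : ZMod n => symbol_neg_notMem (x := x) hn4 hD σ
  have : Fact (1 < n) := ⟨by omega⟩
  have hsign : (-1 : ℂ) ^ n = 1 :=
    (even_iff_two_dvd.mpr ((by norm_num : 2 ∣ 4).trans hn4)).neg_one_pow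
  have hf (x : ZMod n) : AddChar.zmodChar n hsign (-x) = AddChar.zmodChar n hsign x := by
    rw [AddChar.map_neg_eq_inv, AddChar.zmodChar_apply, ← inv_pow, inv_neg_one]
  intro h
  have h01 := AddChar.eq_of_hasPST hC hf (h 0 1 zero_ne_one)
  rw [AddChar.map_zero_eq_one, AddChar.zmodChar_apply, ZMod.val_one] at h01
  norm_num at h01

end
end

section
/- Let n be a positive integer divisible by 8. The number of pairs (D,σ), where D is a set of positive divisors of n/4 and σ : D → {1,−1}, such that {d ∈ D : ν₂(n/d) = 2} = {n/4} and {d ∈ D : ν₂(n/d) = 3} = {n/8} (equivalently, such that the integral oriented circulant graph IOCG_n(D,σ) has multiple state transfer) equals 4 · 3^{τ(n/4) − 2τ(n/2^{ν₂(n)})}. Equivalently, the number of functions f from the set of positive divisors of n/4 to {1, 0, −1} such that {d : f(d) ≠ 0 and ν₂(n/d) = 2} = {n/4} and {d : f(d) ≠ 0 and ν₂(n/d) = 3} = {n/8} equals 4 · 3^{τ(n/4) − 2τ(n/2^{ν₂(n)})}. -/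
open Complex Finset

noncomputable section

/-- The divisors of `2 ^ K * m`, `m` odd, having 2-adic valuation `j ≤ K` correspond to the
divisors of `m`. -/
theorem card_divisors_two_pow_mul_filter_padicValNat {K m j : ℕ} (hm : ¬ 2 ∣ m) (hj : j ≤ K) :
    ((2 ^ K * m).divisors.filter (fun d => padicValNat 2 d = j)).card = m.divisors.card := by
  have hm0 : m ≠ 0 := by rintro rfl; simp at hm
  have himage : (2 ^ K * m).divisors.filter (fun d => padicValNat 2 d = j) =
      m.divisors.image (fun e => 2 ^ j * e) := by
    ext d
    simp only [mem_filter, Nat.mem_divisors, mem_image]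
    constructor
    · rintro ⟨⟨hd, h0⟩, hv⟩
      have hd0 : d ≠ 0 := ne_zero_of_dvd_ne_zero h0 hd
      obtain ⟨e, he⟩ : 2 ^ j ∣ d := hv ▸ pow_padicValNat_dvd
      have he2 : ¬ 2 ∣ e := by
        rintro ⟨c, rfl⟩
        refine pow_succ_padicValNat_not_dvd (p := 2) hd0 ⟨c, ?_⟩
        rw [hv, he]
        ring
      have hcop : Nat.Coprime e (2 ^ K) :=
        Nat.Coprime.pow_right K ((Nat.prime_two.coprime_iff_not_dvd.2 he2).symm)
      refine ⟨e, ⟨hcop.dvd_of_dvd_mul_left ((Dvd.intro_left _ he.symm).trans hd), hm0⟩, he.symm⟩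
    · rintro ⟨e, ⟨he, -⟩, rfl⟩
      have he0 : e ≠ 0 := ne_zero_of_dvd_ne_zero hm0 he
      refine ⟨⟨mul_dvd_mul (pow_dvd_pow 2 hj) he, by positivity⟩, ?_⟩
      rw [padicValNat.mul (by positivity) he0, padicValNat.prime_pow,
        padicValNat.eq_zero_of_not_dvd (fun h => hm (h.trans he)), add_zero]
  rw [himage, card_image_of_injective]
  exact fun a b h => Nat.eq_of_mul_eq_mul_left (by positivity) h

/-- Divisors of `2 ^ (k + 1) * m`, `m` odd, with quotient of `2 ^ (k + 3) * m` of valuation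
neither `2` nor `3`. -/
theorem card_divisors_filter_not_padicValNat_div (k : ℕ) {m : ℕ} (hm : ¬ 2 ∣ m) :
    ((2 ^ (k + 1) * m).divisors.filter (fun d => ¬ (padicValNat 2 (2 ^ (k + 3) * m / d) = 2 ∨
      padicValNat 2 (2 ^ (k + 3) * m / d) = 3))).card =
      (2 ^ (k + 1) * m).divisors.card - 2 * m.divisors.card := by
  have hm0 : m ≠ 0 := by rintro rfl; simp at hm
  have hval : ∀ d ∈ (2 ^ (k + 1) * m).divisors,
      padicValNat 2 (2 ^ (k + 3) * m / d) + padicValNat 2 d = k + 3 := by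
    intro d hd
    have hdvd : d ∣ 2 ^ (k + 3) * m := (Nat.dvd_of_mem_divisors hd).trans
      (mul_dvd_mul_right (pow_dvd_pow 2 (by lia)) m)
    have h0 : 2 ^ (k + 3) * m ≠ 0 := by positivity
    obtain ⟨c, hc⟩ := hdvd
    have hd0 : d ≠ 0 := by rintro rfl; simp at hd
    have hc0 : c ≠ 0 := by rintro rfl; simp_all
    rw [hc, Nat.mul_div_cancel_left c (by lia), add_comm, ← padicValNat.mul hd0 hc0, ← hc,
      padicValNat.mul (by positivity) hm0, padicValNat.prime_pow,
      padicValNat.eq_zero_of_not_dvd hm, add_zero]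
  have hsplit : (2 ^ (k + 1) * m).divisors.filter (fun d =>
      padicValNat 2 (2 ^ (k + 3) * m / d) = 2 ∨ padicValNat 2 (2 ^ (k + 3) * m / d) = 3) =
      (2 ^ (k + 1) * m).divisors.filter (fun d => padicValNat 2 d = k + 1) ∪
        (2 ^ (k + 1) * m).divisors.filter (fun d => padicValNat 2 d = k) := by
    rw [← filter_or]
    refine filter_congr fun d hd => ?_
    have := hval d hd
    lia
  have hcard := card_filter_add_card_filter_not (s := (2 ^ (k + 1) * m).divisors) (fun d =>
      padicValNat 2 (2 ^ (k + 3) * m / d) = 2 ∨ padicValNat 2 (2 ^ (k + 3) * m / d) = 3)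
  rw [hsplit, card_union_of_disjoint (disjoint_filter.2 fun d _ h => by lia),
    card_divisors_two_pow_mul_filter_padicValNat hm le_rfl,
    card_divisors_two_pow_mul_filter_padicValNat hm (Nat.le_succ k)] at hcard
  lia

open scoped Classical in
/-- Counting sign functions on `s` whose support meets `{v = 2}` exactly in `x` and `{v = 3}`
exactly in `y`. -/
theorem card_sign_functions_with_prescribed_support (s : Finset ℕ) (v : ℕ → ℕ) {x y : ℕ}
    (hx : x ∈ s) (hy : y ∈ s) (hvx : v x = 2) (hvy : v y = 3) :
    ((Finset.univ : Finset (↑s → ↑({-1, 0, 1} : Finset ℤ))).filter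
      (fun f => s.filter (fun d => v d = 2 ∧ ∀ h : d ∈ s, (f ⟨d, h⟩ : ℤ) ≠ 0) = {x} ∧
        s.filter (fun d => v d = 3 ∧ ∀ h : d ∈ s, (f ⟨d, h⟩ : ℤ) ≠ 0) = {y})).card =
      4 * 3 ^ (s.filter (fun d => ¬ (v d = 2 ∨ v d = 3))).card := by
  let T : ℕ → Finset ↑({-1, 0, 1} : Finset ℤ) := fun d =>
    univ.filter (fun z => (v d = 2 ∨ v d = 3) → ((z : ℤ) ≠ 0 ↔ (d = x ∨ d = y)))
  have hpi : (Finset.univ : Finset (↑s → ↑({-1, 0, 1} : Finset ℤ))).filter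
      (fun f => s.filter (fun d => v d = 2 ∧ ∀ h : d ∈ s, (f ⟨d, h⟩ : ℤ) ≠ 0) = {x} ∧
        s.filter (fun d => v d = 3 ∧ ∀ h : d ∈ s, (f ⟨d, h⟩ : ℤ) ≠ 0) = {y}) =
      Fintype.piFinset (fun d : ↑s => T d) := by
    ext f
    simp only [mem_filter, mem_univ, true_and, Fintype.mem_piFinset, T, Finset.ext_iff,
      mem_singleton, Subtype.forall]
    constructor
    · rintro ⟨h2, h3⟩ d hd hv
      have := h2 d
      have := h3 d
      grind
    · intro h
      constructor <;> intro d <;> by_cases hd : d ∈ s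
      · have := h d hd
        grind
      · grind
      · have := h d hd
        grind
      · grind
  have hT : ∀ d, (T d).card = (if d = x then 2 else 1) * (if d = y then 2 else 1) *
      (if v d = 2 ∨ v d = 3 then 1 else 3) := by
    have hxy : x ≠ y := by rintro rfl; lia
    have huniv : (univ : Finset ↑({-1, 0, 1} : Finset ℤ)).card = 3 := by decide
    have hne : ((univ : Finset ↑({-1, 0, 1} : Finset ℤ)).filter
      (fun z : ↑({-1, 0, 1} : Finset ℤ) => (z : ℤ) ≠ 0)).card = 2 := by decide
    have heq : ((univ : Finset ↑({-1, 0, 1} : Finset ℤ)).filter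
      (fun z : ↑({-1, 0, 1} : Finset ℤ) => (z : ℤ) = 0)).card = 1 := by decide
    intro d
    by_cases hd : v d = 2 ∨ v d = 3
    · by_cases hdx : d = x
      · subst hdx
        rw [show T d = univ.filter (fun z => z.1 ≠ 0) by ext z; simp [T, hd], hne]
        simp [hd, hxy]
      · by_cases hdy : d = y
        · subst hdy
          rw [show T d = univ.filter (fun z => z.1 ≠ 0) by ext z; simp [T, hd], hne]
          simp [hd, hdx]
        · rw [show T d = univ.filter (fun z => z.1 = 0) by ext z; simp [T, hd, hdx, hdy], heq]
          simp [hd, hdx, hdy]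
    · have hdx : d ≠ x := by rintro rfl; exact hd (Or.inl hvx)
      have hdy : d ≠ y := by rintro rfl; exact hd (Or.inr hvy)
      rw [show T d = univ by ext z; simp [T, hd], huniv]
      simp [hd, hdx, hdy]
  have hprod : ∏ d : ↑s, (T d).card = ∏ d ∈ s, (T d).card :=
    Finset.prod_coe_sort s (fun d => (T d).card)
  rw [hpi, Fintype.card_piFinset, hprod]
  simp only [hT, prod_mul_distrib, prod_ite_eq', hx, hy, if_true, prod_ite, prod_const_one,
    prod_const, one_mul]
  norm_num

open scoped Classical in
theorem count_mst (n : ℕ) (hn0 : 0 < n) (hn8 : 8 ∣ n) :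
    ((Finset.univ :
        Finset (↑((n / 4).divisors) → ↑({-1, 0, 1} : Finset ℤ))).filter
      (fun f => (n / 4).divisors.filter (fun d => padicValNat 2 (n / d) = 2 ∧
          ∀ h : d ∈ (n / 4).divisors, (f ⟨d, h⟩ : ℤ) ≠ 0) = {n / 4} ∧
        (n / 4).divisors.filter (fun d => padicValNat 2 (n / d) = 3 ∧
          ∀ h : d ∈ (n / 4).divisors, (f ⟨d, h⟩ : ℤ) ≠ 0) = {n / 8})).card =
      4 * 3 ^ ((n / 4).divisors.card - 2 * (n / 2 ^ (padicValNat 2 n)).divisors.card) := by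
  obtain ⟨k, m, hm, rfl⟩ : ∃ k m, ¬ 2 ∣ m ∧ n = 2 ^ (k + 3) * m := by
    obtain ⟨a, m, hm, hn⟩ := Nat.exists_eq_pow_mul_and_not_dvd hn0.ne' 2 (by norm_num)
    have ha : 3 ≤ a := by
      have h8 : 2 ^ 3 ∣ 2 ^ a * m := hn ▸ hn8
      have hcop : Nat.Coprime (2 ^ 3) m :=
        Nat.Coprime.pow_left 3 (Nat.prime_two.coprime_iff_not_dvd.2 hm)
      exact (Nat.pow_dvd_pow_iff_le_right (by norm_num)).1 (hcop.dvd_of_dvd_mul_right h8)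
    exact ⟨a - 3, m, hm, by rw [Nat.sub_add_cancel ha, hn]⟩
  have hm0 : m ≠ 0 := by rintro rfl; simp at hm
  have h4 : 2 ^ (k + 3) * m / 4 = 2 ^ (k + 1) * m :=
    Nat.div_eq_of_eq_mul_left (by norm_num) (by ring)
  have h8 : 2 ^ (k + 3) * m / 8 = 2 ^ k * m :=
    Nat.div_eq_of_eq_mul_left (by norm_num) (by ring)
  have hval : padicValNat 2 (2 ^ (k + 3) * m) = k + 3 := by
    rw [padicValNat.mul (by positivity) hm0, padicValNat.prime_pow,
      padicValNat.eq_zero_of_not_dvd hm, add_zero]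
  have hdiv4 : 2 ^ (k + 3) * m / (2 ^ (k + 1) * m) = 2 ^ 2 :=
    Nat.div_eq_of_eq_mul_left (by positivity) (by ring)
  have hdiv8 : 2 ^ (k + 3) * m / (2 ^ k * m) = 2 ^ 3 :=
    Nat.div_eq_of_eq_mul_left (by positivity) (by ring)
  rw [h4, h8, hval, Nat.mul_div_cancel_left m (by positivity),
    ← card_divisors_filter_not_padicValNat_div k hm]
  refine card_sign_functions_with_prescribed_support _
    (fun d => padicValNat 2 (2 ^ (k + 3) * m / d)) ?_ ?_ ?_ ?_
  · exact Nat.mem_divisors_self _ (by positivity)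
  · exact Nat.mem_divisors.2 ⟨mul_dvd_mul_right (pow_dvd_pow 2 (Nat.le_succ k)) m, by positivity⟩
  · simp only [hdiv4, padicValNat.prime_pow]
  · simp only [hdiv8, padicValNat.prime_pow]

end
end
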